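/- Let (R, m) be a two-dimensional regular local ring, and I an m-primary integrally closed ideal containing a parameter ideal Q = (a,b) with I^2 = QI. Then the ideal J = Q : I is integrally closed. -/

import Mathlib

open IsLocalRing

/-- An ideal `I` of a commutative ring is integrally closed if every element `x`
satisfying an equation of integral dependence `x^n + c₁ x^{n-1} + ⋯ + cₙ = 0`
with `cᵢ ∈ I^i` already lies in `I`. -/
def Ideal.IsIntegrallyClosedIdeal {R : Type*} [CommRing R] (I : Ideal R) : Prop :=
  ∀ x : R, (∃ n : ℕ, 0 < n ∧ ∃ c : ℕ → R, (∀ i, 1 ≤ i → i ≤ n → c i ∈ I ^ i) ∧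
      x ^ n + ∑ i ∈ Finset.Icc 1 n, c i * x ^ (n - i) = 0) → x ∈ I

open IsLocalRing

namespace Stmt19

section General

variable {K : Type*} [Field K]

/-- The subring `D[t]` of `K`. -/
noncomputable def adj (D : Subring K) (t : K) : Subring K :=
  (Polynomial.eval₂RingHom D.subtype t).range

lemma mem_adj {D : Subring K} {t z : K} :
    z ∈ adj D t ↔ ∃ F : Polynomial D, F.eval₂ D.subtype t = z := by
  simp [adj, RingHom.mem_range]

lemma le_adj (D : Subring K) (t : K) : D ≤ adj D t := by
  intro z hz
  exact mem_adj.2 ⟨Polynomial.C ⟨z, hz⟩, by simp⟩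

lemma self_mem_adj (D : Subring K) (t : K) : t ∈ adj D t :=
  mem_adj.2 ⟨Polynomial.X, by simp⟩

lemma adj_le {D E : Subring K} {t : K} (h : D ≤ E) (ht : t ∈ E) : adj D t ≤ E := by
  intro z hz
  obtain ⟨F, rfl⟩ := mem_adj.1 hz
  rw [Polynomial.eval₂_eq_sum_range]
  exact sum_mem fun i _ => mul_mem (h (F.coeff i).2) (pow_mem ht i)

lemma adj_le_iff {D E : Subring K} {t : K} : adj D t ≤ E ↔ D ≤ E ∧ t ∈ E :=
  ⟨fun h => ⟨(le_adj D t).trans h, h (self_mem_adj D t)⟩, fun h => adj_le h.1 h.2⟩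

lemma cl_iff (D : Subring K) (f : K) :
    IsIntegral D f ↔ ∀ V : ValuationSubring K, D ≤ V.toSubring → f ∈ V := by
  constructor
  · intro h V hV
    have : IsIntegrallyClosedIn V.toSubring K := inferInstanceAs (IsIntegrallyClosedIn V K)
    have h2 := (Subring.integralClosure_le_iff (R := D) (T := V.toSubring)).2 (fun r => hV r.2)
    exact h2 h
  · intro h
    have := iInf_valuationSubring_superset (s := (D : Set K))
    have h2 : f ∈ (⨅ V : {V : ValuationSubring K // (D : Set K) ⊆ V.toSubring},
        V.1.toSubring) := by
      rw [Subring.mem_iInf]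
      intro V
      exact h V.1 V.2
    rw [this] at h2
    have h3 : Subring.closure (D : Set K) = D := Subring.closure_eq D
    have h4 : IsIntegral (Subring.closure (D : Set K)) f := h2
    rw [h3] at h4
    exact h4

lemma cl_adj_iff (D : Subring K) (T f : K) :
    IsIntegral (adj D T) f ↔
      ∀ V : ValuationSubring K, D ≤ V.toSubring → T ∈ V → f ∈ V := by
  rw [cl_iff]
  constructor
  · intro h V h1 h2; exact h V (adj_le h1 h2)
  · intro h V h1
    exact h V ((le_adj D T).trans h1) (h1 (self_mem_adj D T))

lemma int_of_eq {E : Subring K} {x y : K} (h : IsIntegral E x) (e : y = x) : IsIntegral E y :=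
  e ▸ h

lemma int_mul {E : Subring K} {c x : K} (hc : c ∈ E) (h : IsIntegral E x) :
    IsIntegral E (c * x) :=
  IsIntegral.mul (isIntegral_algebraMap (x := (⟨c, hc⟩ : E))) h

lemma integral_scale {E E' : Subring K} (M : Submonoid K) (hM : ∀ s ∈ M, s ∈ E)
    (h : ∀ e ∈ E', ∃ s ∈ M, s * e ∈ E) {g : K} (hg : IsIntegral E' g) :
    ∃ s ∈ M, IsIntegral E (s * g) := by
  obtain ⟨p, hp, hpe⟩ := hg
  have key : ∀ n : ℕ, ∃ s ∈ M, ∀ i < n, s * (p.coeff i : K) ∈ E := by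
    intro n
    induction n with
    | zero => exact ⟨1, one_mem _, by simp⟩
    | succ n ih =>
      obtain ⟨s, hs, h1⟩ := ih
      obtain ⟨s', hs', h2⟩ := h (p.coeff n) (p.coeff n).2
      refine ⟨s * s', mul_mem hs hs', fun i hi => ?_⟩
      rcases Nat.lt_succ_iff_lt_or_eq.1 hi with hi | rfl
      · have := mul_mem (hM s' hs') (h1 i hi)
        convert this using 1; ring
      · have := mul_mem (hM s hs) h2
        convert this using 1; ring
  obtain ⟨s, hs, h1⟩ := key p.natDegree
  refine ⟨s, hs, ?_⟩
  set P : Polynomial K := p.map E'.subtype with hP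
  have hPm : P.Monic := hp.map _
  have hPd : P.natDegree = p.natDegree := hp.natDegree_map _
  have hPe : P.eval g = 0 := by
    rw [hP, Polynomial.eval_map]; exact hpe
  set Q := P.scaleRoots s with hQ
  have hQm : Q.Monic := (Polynomial.monic_scaleRoots_iff s).2 hPm
  have hQe : Q.eval (s * g) = 0 := by
    have := Polynomial.scaleRoots_eval₂_mul (p := P) (RingHom.id K) g s
    simp only [RingHom.id_apply] at this
    rw [Polynomial.eval, this]
    change s ^ _ * P.eval g = 0
    rw [hPe, mul_zero]
  have hQc : (↑Q.coeffs : Set K) ⊆ E := by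
    intro c hc
    obtain ⟨i, hi, rfl⟩ := Polynomial.mem_coeffs_iff.1 hc
    rw [hQ, Polynomial.coeff_scaleRoots]
    rcases lt_trichotomy i P.natDegree with hlt | heq | hgt
    · have e : P.coeff i * s ^ (P.natDegree - i)
          = s * (p.coeff i : K) * s ^ (P.natDegree - i - 1) := by
        obtain ⟨k, hk⟩ : ∃ k, P.natDegree - i = k + 1 := ⟨P.natDegree - i - 1, by omega⟩
        rw [hk, hP, Polynomial.coeff_map]
        simp only [Subring.coe_subtype, Nat.add_sub_cancel]
        ring
      rw [e]
      exact mul_mem (h1 i (hPd ▸ hlt)) (pow_mem (hM s hs) _)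
    · rw [heq, hPm.coeff_natDegree]; simp
    · rw [Polynomial.coeff_eq_zero_of_natDegree_lt hgt]; simp
  refine ⟨Q.toSubring E hQc, (Polynomial.monic_toSubring Q E hQc).2 hQm, ?_⟩
  have : (Q.toSubring E hQc).map E.subtype = Q := Polynomial.map_toSubring Q E hQc
  change Polynomial.eval₂ E.subtype _ _ = 0
  rw [← Polynomial.eval_map, this, hQe]

/-- Vanishing of the first cohomology for the cover given by `T` and `T⁻¹`. -/
def Pp (D : Subring K) (T : K) : Prop :=
  ∀ f : K, (∀ V : ValuationSubring K, D ≤ V.toSubring → T ∈ V → T⁻¹ ∈ V → f ∈ V) →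
    ∃ g : K, (∀ V : ValuationSubring K, D ≤ V.toSubring → T ∈ V → g ∈ V) ∧
      (∀ V : ValuationSubring K, D ≤ V.toSubring → T⁻¹ ∈ V → f - g ∈ V)

lemma Pp_symm {D : Subring K} {T : K} (h : Pp D T⁻¹) : Pp D T := by
  intro f hf
  obtain ⟨g, h1, h2⟩ := h f (fun V a b c => hf V a (by simpa using c) b)
  exact ⟨f - g, fun V a b => h2 V a (by simpa using b), fun V a b => by simpa using h1 V a b⟩

lemma Pp_of_mem {D : Subring K} {T : K} (h : T ∈ D) : Pp D T := by
  intro f hf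
  exact ⟨0, fun V _ _ => zero_mem _, fun V a b => by simpa using hf V a (a h) b⟩

lemma Pp_of_inv_mem {D : Subring K} {T : K} (h : T⁻¹ ∈ D) : Pp D T :=
  Pp_symm (Pp_of_mem h)

lemma mem_ofPrime {D : Subring K} {N : Ideal D} [N.IsPrime] {z : K} :
    z ∈ (LocalSubring.ofPrime D N).toSubring ↔ ∃ s : D, s ∉ N ∧ (s : K) * z ∈ D := by
  constructor
  · intro hz
    obtain ⟨⟨c, s⟩, h⟩ := IsLocalization.surj (M := N.primeCompl)
      (⟨z, hz⟩ : (LocalSubring.ofPrime D N).toSubring)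
    refine ⟨s, s.2, ?_⟩
    have := congrArg Subtype.val h
    change z * (s : D) = (c : K) at this
    rw [mul_comm, this]; exact c.2
  · rintro ⟨s, hs, hz⟩
    have hs0 : (s : K) ≠ 0 := by
      intro h0
      apply hs
      have : s = 0 := Subtype.ext h0
      rw [this]; exact zero_mem _
    have hu := IsLocalization.map_units (M := N.primeCompl)
      (LocalSubring.ofPrime D N).toSubring ⟨s, hs⟩
    obtain ⟨u, hu1⟩ := hu.exists_right_inv
    have := congrArg Subtype.val hu1
    change (s : K) * (u : K) = 1 at this
    have e : z = (s * z) * u := by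
      rw [mul_comm (s : K) z, mul_assoc, this, mul_one]
    rw [e]
    exact mul_mem (LocalSubring.le_ofPrime D N hz) u.2

lemma Pp_local {D : Subring K} {T : K}
    (h : ∀ (N : Ideal D) [N.IsMaximal], Pp (LocalSubring.ofPrime D N).toSubring T) : Pp D T := by
  intro f hf
  let 𝔧 : Ideal D :=
    { carrier := {s | ∃ g : K, IsIntegral (adj D T) g ∧ IsIntegral (adj D T⁻¹) ((s : K) * f - g)}
      zero_mem' := ⟨0, isIntegral_zero, by simpa using isIntegral_zero⟩
      add_mem' := by
        rintro s s' ⟨g, h1, h2⟩ ⟨g', h1', h2'⟩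
        refine ⟨g + g', h1.add h1', ?_⟩
        refine int_of_eq (h2.add h2') ?_
        push_cast; ring
      smul_mem' := by
        rintro c s ⟨g, h1, h2⟩
        refine ⟨c * g, ?_, ?_⟩
        · exact int_mul (le_adj D T c.2) h1
        · refine int_of_eq (int_mul (le_adj D T⁻¹ c.2) h2) ?_
          rw [smul_eq_mul]
          push_cast; ring }
  by_cases htop : 𝔧 = ⊤
  · have : (1 : D) ∈ 𝔧 := by rw [htop]; trivial
    obtain ⟨g, h1, h2⟩ := this
    refine ⟨g, (cl_adj_iff _ _ _).1 h1, (cl_adj_iff _ _ _).1 (by simpa using h2)⟩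
  · exfalso
    obtain ⟨N, hN, hle⟩ := Ideal.exists_le_maximal 𝔧 htop
    have hND := LocalSubring.le_ofPrime D N
    obtain ⟨g, h1, h2⟩ := h N f (fun V a b c => hf V (hND.trans a) b c)
    rw [← cl_adj_iff] at h1 h2
    let M : Submonoid K := N.primeCompl.map D.subtype
    have key : ∀ U : K, ∀ e ∈ adj (LocalSubring.ofPrime D N).toSubring U,
        ∃ s ∈ M, s * e ∈ adj D U := by
      intro U e he
      obtain ⟨F, rfl⟩ := mem_adj.1 he
      induction F using Polynomial.induction_on' with
      | add p q hp hq =>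
        obtain ⟨s, hs, h1⟩ := hp (mem_adj.2 ⟨p, rfl⟩)
        obtain ⟨s', hs', h2⟩ := hq (mem_adj.2 ⟨q, rfl⟩)
        refine ⟨s * s', mul_mem hs hs', ?_⟩
        have a1 : s ∈ D := by obtain ⟨w, _, rfl⟩ := hs; exact w.2
        have a2 : s' ∈ D := by obtain ⟨w, _, rfl⟩ := hs'; exact w.2
        have := add_mem (mul_mem (le_adj D U a2) h1) (mul_mem (le_adj D U a1) h2)
        convert this using 1
        rw [Polynomial.eval₂_add]; ring
      | monomial n c =>
        obtain ⟨s, hs, h1⟩ := mem_ofPrime.1 c.2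
        refine ⟨s, ⟨s, hs, rfl⟩, ?_⟩
        rw [Polynomial.eval₂_monomial]
        have := mul_mem (le_adj D U h1) (pow_mem (self_mem_adj D U) n)
        convert this using 1
        simp [mul_assoc]
    have hMD : ∀ s ∈ M, s ∈ D := by
      rintro _ ⟨w, _, rfl⟩; exact w.2
    obtain ⟨s, hs, i1⟩ := integral_scale M (fun s hs => le_adj D T (hMD s hs)) (key T) h1
    obtain ⟨s', hs', i2⟩ := integral_scale M (fun s hs => le_adj D _ (hMD s hs)) (key T⁻¹) h2
    have hmem : ∃ w : D, w ∉ N ∧ (w : K) = s * s' := by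
      obtain ⟨w, hw, e⟩ := mul_mem hs hs'
      exact ⟨w, hw, e⟩
    obtain ⟨w, hw, e⟩ := hmem
    apply hw
    apply hle
    refine ⟨s' * (s * g), ?_, ?_⟩
    · exact int_mul (le_adj D T (hMD _ hs')) i1
    · refine int_of_eq (int_mul (le_adj D T⁻¹ (hMD _ hs)) i2) ?_
      rw [e]
      ring

lemma Pp_glue {D : Subring K} {T t : K}
    (h12 : ∀ δ : K, (∀ V : ValuationSubring K, D ≤ V.toSubring → t ∈ V → t⁻¹ ∈ V → δ ∈ V) →
      ∃ r ∈ adj D t, δ - r ∈ adj D t⁻¹)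
    (h1 : Pp (adj D t) T) (h2 : Pp (adj D t⁻¹) T) : Pp D T := by
  intro f hf
  obtain ⟨g1, a1, b1⟩ := h1 f (fun V a b c => hf V ((le_adj D t).trans a) b c)
  obtain ⟨g2, a2, b2⟩ := h2 f (fun V a b c => hf V ((le_adj D _).trans a) b c)
  obtain ⟨r, hr, hr2⟩ := h12 (g1 - g2) (by
    intro V hV ht ht'
    have v1 := adj_le hV ht
    have v2 := adj_le hV ht'
    rcases V.mem_or_inv_mem T with hT | hT
    · exact sub_mem (a1 V v1 hT) (a2 V v2 hT)
    · have := sub_mem (b2 V v2 hT) (b1 V v1 hT)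
      convert this using 1; ring)
  have e : g1 - r = g2 + (g1 - g2 - r) := by ring
  refine ⟨g1 - r, ?_, ?_⟩
  · intro V hV hT
    rcases V.mem_or_inv_mem t with ht | ht
    · have v1 := adj_le hV ht
      exact sub_mem (a1 V v1 hT) (v1 hr)
    · have v2 := adj_le hV ht
      rw [e]
      exact add_mem (a2 V v2 hT) (v2 hr2)
  · intro V hV hT
    rcases V.mem_or_inv_mem t with ht | ht
    · have v1 := adj_le hV ht
      have := add_mem (b1 V v1 hT) (v1 hr)
      convert this using 1; ring
    · have v2 := adj_le hV ht
      have := sub_mem (b2 V v2 hT) (v2 hr2)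
      convert this using 1; ring

end General

end Stmt19

open IsLocalRing

namespace Stmt19

section LocalLemmas

variable {R : Type*} [CommRing R]

lemma dvr_form [IsNoetherianRing R] [IsLocalRing R] {x y : R}
    (hm : maximalIdeal R = Ideal.span {x, y}) {c : R} (hc : ¬ x ∣ c) :
    ∃ (j : ℕ) (u : R), IsUnit u ∧ x ∣ c - u * y ^ j := by
  have hcx : c ∉ Ideal.span {x} := by rwa [Ideal.mem_span_singleton]
  have hxm : x ∈ maximalIdeal R := by rw [hm]; exact Ideal.subset_span (by simp)
  have hym : y ∈ maximalIdeal R := by rw [hm]; exact Ideal.subset_span (by simp)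
  have hne : Ideal.span {x} ≠ (⊤ : Ideal R) := by
    intro h; rw [h] at hcx; exact hcx trivial
  have : Nontrivial (R ⧸ Ideal.span {x}) := Ideal.Quotient.nontrivial_iff.2 hne
  have : IsLocalRing (R ⧸ Ideal.span {x}) :=
    IsLocalRing.of_surjective' _ Ideal.Quotient.mk_surjective
  set π := Ideal.Quotient.mk (Ideal.span {x}) with hπ
  have hney : Ideal.span {π y} ≠ ⊤ := by
    intro h
    rw [Ideal.span_singleton_eq_top] at h
    obtain ⟨w, hw⟩ := h.exists_right_inv
    obtain ⟨w, rfl⟩ := Ideal.Quotient.mk_surjective w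
    have h1 : y * w - 1 ∈ Ideal.span {x} := by
      rw [← Ideal.Quotient.eq]; simpa using hw
    have h2 : y * w - 1 ∈ maximalIdeal R :=
      (Ideal.span_singleton_le_iff_mem _).2 hxm h1
    have h3 : (1 : R) ∈ maximalIdeal R := by
      have := sub_mem (Ideal.mul_mem_right w _ hym) h2
      rwa [sub_sub_cancel] at this
    exact (Ideal.ne_top_iff_one _).1 (maximalIdeal.isMaximal R).ne_top h3
  have hk := Ideal.iInf_pow_eq_bot_of_isLocalRing (Ideal.span {π y}) hney
  have hc0 : π c ≠ 0 := by
    intro h; exact hcx (Ideal.Quotient.eq_zero_iff_mem.1 h)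
  have hex : ∃ i, π c ∉ Ideal.span {π y} ^ i := by
    by_contra! hcon
    apply hc0
    have : π c ∈ (⨅ i : ℕ, Ideal.span {π y} ^ i) := by
      rw [Ideal.mem_iInf]; exact hcon
    rw [hk] at this; simpa using this
  classical
  have hspec := Nat.find_spec hex
  obtain ⟨j, hj⟩ : ∃ j, Nat.find hex = j + 1 := by
    refine Nat.exists_eq_succ_of_ne_zero ?_
    intro h0
    rw [h0] at hspec; simp at hspec
  have hmin : π c ∈ Ideal.span {π y} ^ j := by
    by_contra h
    have := Nat.find_min' hex h
    omega
  rw [hj] at hspec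
  rw [Ideal.span_singleton_pow, Ideal.mem_span_singleton] at hspec hmin
  obtain ⟨u, hu⟩ := hmin
  obtain ⟨u, rfl⟩ := Ideal.Quotient.mk_surjective u
  refine ⟨j, u, ?_, ?_⟩
  · by_contra hnu
    have hum : u ∈ maximalIdeal R := (mem_maximalIdeal u).2 hnu
    rw [hm, Ideal.mem_span_pair] at hum
    obtain ⟨p, q, rfl⟩ := hum
    apply hspec
    have hx0 : π x = 0 := Ideal.Quotient.eq_zero_iff_mem.2 (Ideal.mem_span_singleton_self x)
    refine ⟨π q, ?_⟩
    rw [hu]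
    change (π y) ^ j * π (p * x + q * y) = _
    rw [map_add, map_mul, map_mul, hx0]; ring
  · rw [← Ideal.mem_span_singleton, ← Ideal.Quotient.eq]
    change π c = π _
    rw [hu, map_mul, map_pow, mul_comm]

lemma prime_of_not_dvd_pow [IsNoetherianRing R] [IsLocalRing R] {x y : R} (hx0 : x ≠ 0)
    (hm : maximalIdeal R = Ideal.span {x, y}) (h : ∀ n, ¬ x ∣ y ^ n) : Prime x := by
  have hxm : x ∈ maximalIdeal R := by rw [hm]; exact Ideal.subset_span (by simp)
  refine ⟨hx0, (mem_maximalIdeal x).1 hxm, fun c d hcd => ?_⟩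
  by_contra! hcon
  obtain ⟨hc, hd⟩ := hcon
  obtain ⟨j, u, hu, h1⟩ := dvr_form hm hc
  obtain ⟨k, v, hv, h2⟩ := dvr_form hm hd
  have h3 : x ∣ (u * v) * y ^ (j + k) := by
    have e : (u * v) * y ^ (j + k) = c * d - c * (d - v * y ^ k) - (c - u * y ^ j) * (v * y ^ k) := by
      ring
    rw [e]
    exact dvd_sub (dvd_sub hcd (h2.mul_left _)) (h1.mul_right _)
  exact h _ (((hu.mul hv).dvd_mul_left).1 h3)

lemma ufd_of [IsDomain R] [IsNoetherianRing R] [IsLocalRing R] {x y : R}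
    (hm : maximalIdeal R = Ideal.span {x, y}) (hx : Prime x) :
    UniqueFactorizationMonoid R := by
  rw [UniqueFactorizationMonoid.iff_exists_prime_mem_of_isPrime]
  intro p hp0 hp
  by_cases hxp : x ∈ p
  · exact ⟨x, hxp, hx⟩
  have hxm : x ∈ maximalIdeal R := by rw [hm]; exact Ideal.subset_span (by simp)
  have hjac : Ideal.span {x} ≤ Ideal.jacobson (⊥ : Ideal R) := by
    rw [IsLocalRing.jacobson_eq_maximalIdeal _ bot_ne_top]
    exact (Ideal.span_singleton_le_iff_mem _).2 hxm
  have hsub : ∀ e ∈ p, x ∣ e → e ∈ Ideal.span {x} • p := by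
    rintro _ he ⟨e, rfl⟩
    have := (hp.mem_or_mem he).resolve_left hxp
    exact Submodule.smul_mem_smul (Ideal.mem_span_singleton_self x) this
  have hex : ∃ j : ℕ, ∃ c ∈ p, ∃ u : R, IsUnit u ∧ x ∣ c - u * y ^ j := by
    have : ∃ c ∈ p, ¬ x ∣ c := by
      by_contra! hcon
      apply hp0
      exact Submodule.eq_bot_of_le_smul_of_le_jacobson_bot (Ideal.span {x}) p
        (IsNoetherian.noetherian p) (fun e he => hsub e he (hcon e he)) hjac
    obtain ⟨c, hc, hxc⟩ := this
    obtain ⟨j, u, hu, h⟩ := dvr_form hm hxc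
    exact ⟨j, c, hc, u, hu, h⟩
  classical
  obtain ⟨c, hc, u, hu, h⟩ := Nat.find_spec hex
  set j := Nat.find hex with hj
  have hle : p ≤ Ideal.span {c} ⊔ Ideal.span {x} • p := by
    intro e he
    by_cases hxe : x ∣ e
    · exact Submodule.mem_sup_right (hsub e he hxe)
    obtain ⟨k, v, hv, hk⟩ := dvr_form hm hxe
    have hjk : j ≤ k := Nat.find_min' hex ⟨e, he, v, hv, hk⟩
    obtain ⟨l, rfl⟩ := Nat.exists_eq_add_of_le hjk
    obtain ⟨w, hw⟩ := hu.exists_left_inv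
    have hd : x ∣ e - c * (w * v * y ^ l) := by
      have e1 : e - c * (w * v * y ^ l) = (e - v * y ^ (j + l))
          - (c - u * y ^ j) * (w * v * y ^ l) := by
        have : v * y ^ (j + l) = (w * u) * v * y ^ (j + l) := by rw [hw, one_mul]
        rw [this]; ring
      rw [e1]
      exact dvd_sub hk (h.mul_right _)
    have hmem : e - c * (w * v * y ^ l) ∈ p := sub_mem he (Ideal.mul_mem_right _ _ hc)
    have := Submodule.add_mem_sup (Ideal.mem_span_singleton.2 (Dvd.intro _ rfl))
      (hsub _ hmem hd) (S := Ideal.span {c}) (s := c * (w * v * y ^ l))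
    simpa using this
  have hle2 : p ≤ Ideal.span {c} :=
    Submodule.le_of_le_smul_of_le_jacobson_bot (IsNoetherian.noetherian p) hjac hle
  have heq : p = Ideal.span {c} :=
    le_antisymm hle2 ((Ideal.span_singleton_le_iff_mem _).2 hc)
  refine ⟨c, hc, ?_⟩
  have hc0 : c ≠ 0 := by
    rintro rfl
    apply hp0; rw [heq]; simp
  rw [← Ideal.span_singleton_prime hc0, ← heq]
  exact hp

/-- `b` is regular modulo `a`. -/
def Rg (a b : R) : Prop := ∀ c e : R, b * c = a * e → a ∣ c

lemma Rg.symm [IsDomain R] {a b : R} (ha : a ≠ 0) (h : Rg a b) : Rg b a := by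
  intro c e hce
  obtain ⟨k, rfl⟩ := h e c hce.symm
  refine ⟨k, mul_left_cancel₀ ha ?_⟩
  rw [hce]; ring

lemma Rg.pow {a b : R} (h : Rg a b) (n : ℕ) : ∀ c e : R, b ^ n * c = a * e → a ∣ c := by
  induction n with
  | zero => intro c e hce; exact ⟨e, by simpa using hce⟩
  | succ n ih =>
    intro c e hce
    obtain ⟨k, hk⟩ := ih (b * c) e (by rw [← hce]; ring)
    exact h c k hk

variable {K : Type*} [Field K] [Algebra R K]

lemma clear_den {a b : R} (ha : algebraMap R K a ≠ 0) (n : ℕ) (G : Polynomial R)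
    (hG : G.natDegree ≤ n) : ∃ e ∈ (Ideal.span {a, b}) ^ n,
      algebraMap R K e = algebraMap R K a ^ n *
      Polynomial.aeval (algebraMap R K b / algebraMap R K a) G := by
  refine ⟨∑ i ∈ Finset.range (n + 1), G.coeff i * (b ^ i * a ^ (n - i)), ?_, ?_⟩
  · refine sum_mem fun i hi => Ideal.mul_mem_left _ _ ?_
    have hi' : i ≤ n := by simpa [Nat.lt_succ_iff] using hi
    have e : (Ideal.span {a, b}) ^ n = (Ideal.span {a, b}) ^ i * (Ideal.span {a, b}) ^ (n - i) := by
      rw [← pow_add]; congr 1; omega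
    rw [e]
    exact Ideal.mul_mem_mul (Ideal.pow_mem_pow (Ideal.subset_span (by simp)) _)
      (Ideal.pow_mem_pow (Ideal.subset_span (by simp)) _)
  · rw [Polynomial.aeval_eq_sum_range' (n := n + 1) (by omega), map_sum, Finset.mul_sum]
    refine Finset.sum_congr rfl fun i hi => ?_
    have hi' : i ≤ n := by simpa [Nat.lt_succ_iff] using hi
    obtain ⟨k, rfl⟩ := Nat.exists_eq_add_of_le hi'
    rw [Algebra.smul_def, div_pow, Nat.add_sub_cancel_left]
    simp only [map_mul, map_pow]
    field_simp
    ring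

lemma coeff_mem_of_aeval_eq_zero [FaithfulSMul R K] {a b : R} (ha : a ≠ 0) (h : Rg a b) (n : ℕ) :
    ∀ F : Polynomial R, F.natDegree ≤ n →
      Polynomial.aeval (algebraMap R K b / algebraMap R K a) F = 0 →
      ∀ i, F.coeff i ∈ Ideal.span {a, b} := by
  have hinj : Function.Injective (algebraMap R K) := FaithfulSMul.algebraMap_injective R K
  have haK : algebraMap R K a ≠ 0 := by
    rwa [Ne, map_eq_zero_iff _ hinj]
  induction n with
  | zero =>
    intro F hF h0 i
    rw [Polynomial.eq_C_of_natDegree_le_zero hF] at h0 ⊢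
    rw [Polynomial.aeval_C, map_eq_zero_iff _ hinj] at h0
    rw [h0]; simp
  | succ n ih =>
    intro F hF h0 i
    set c := F.coeff (n + 1) with hc
    set G := F - Polynomial.C c * Polynomial.X ^ (n + 1) with hG
    have hGd : G.natDegree ≤ n := by
      rw [Polynomial.natDegree_le_iff_coeff_eq_zero]
      intro N hN
      rw [hG, Polynomial.coeff_sub, Polynomial.coeff_C_mul_X_pow]
      split_ifs with hh
      · rw [hh, hc, sub_self]
      · rw [sub_zero]
        apply Polynomial.coeff_eq_zero_of_natDegree_lt
        omega
    obtain ⟨e, -, he⟩ := clear_den (K := K) (b := b) haK n G hGd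
    have h1 : b ^ (n + 1) * c = a * (-e) := by
      apply hinj
      rw [map_mul, map_mul, map_neg, he, hG, map_sub, h0]
      simp only [map_mul, map_pow, Polynomial.aeval_C, Polynomial.aeval_X, div_pow]
      field_simp
      ring
    obtain ⟨d, hd⟩ := h.pow _ _ _ h1
    set F' := F - Polynomial.C d * Polynomial.X ^ n *
      (Polynomial.C a * Polynomial.X - Polynomial.C b) with hF'
    have e2 : F' = G + Polynomial.C (d * b) * Polynomial.X ^ n := by
      rw [hF', hG, hd]
      simp only [map_mul]
      ring
    have hF'd : F'.natDegree ≤ n := by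
      rw [e2]
      refine Polynomial.natDegree_add_le_of_degree_le hGd ?_
      exact Polynomial.natDegree_C_mul_X_pow_le _ _
    have hF'0 : Polynomial.aeval (algebraMap R K b / algebraMap R K a) F' = 0 := by
      rw [hF', map_sub, h0]
      simp only [map_mul, map_sub, Polynomial.aeval_C, Polynomial.aeval_X, map_pow]
      field_simp
      ring
    have h3 := ih F' hF'd hF'0 i
    have e3 : F.coeff i = F'.coeff i + (Polynomial.C d * Polynomial.X ^ n *
      (Polynomial.C a * Polynomial.X - Polynomial.C b)).coeff i := by
      rw [← Polynomial.coeff_add, hF']; simp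
    rw [e3]
    refine add_mem h3 ?_
    have hmem : (Polynomial.C d * Polynomial.X ^ n *
      (Polynomial.C a * Polynomial.X - Polynomial.C b)) ∈
        Ideal.map Polynomial.C (Ideal.span {a, b}) := by
      refine Ideal.mul_mem_left _ _ (sub_mem (Ideal.mul_mem_right _ _ ?_) ?_) <;>
      exact Ideal.mem_map_of_mem _ (Ideal.subset_span (by simp))
    exact Ideal.mem_map_C_iff.1 hmem i

end LocalLemmas

end Stmt19

open IsLocalRing

namespace Stmt19

section Length

variable {R M : Type*} [CommRing R] [AddCommGroup M] [Module R M]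

/-- Relative length. -/
noncomputable def ql (A B : Submodule R M) : ℕ∞ := Module.length R (A ⧸ B.comap A.subtype)

lemma ql_add {A B C : Submodule R M} (hBA : B ≤ A) (hCB : C ≤ B) :
    ql A C = ql B C + ql A B := by
  let f : (B ⧸ C.comap B.subtype) →ₗ[R] (A ⧸ C.comap A.subtype) :=
    Submodule.mapQ _ _ (Submodule.inclusion hBA) (by intro z hz; exact hz)
  let g : (A ⧸ C.comap A.subtype) →ₗ[R] (A ⧸ B.comap A.subtype) :=
    Submodule.mapQ _ _ LinearMap.id (by intro z hz; exact hCB hz)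
  refine Module.length_eq_add_of_exact f g ?_ ?_ ?_
  · rw [← LinearMap.ker_eq_bot, LinearMap.ker_eq_bot']
    intro z hz
    obtain ⟨z, rfl⟩ := Submodule.Quotient.mk_surjective _ z
    rw [Submodule.Quotient.mk_eq_zero]
    exact (Submodule.Quotient.mk_eq_zero (C.comap A.subtype)
      (x := Submodule.inclusion hBA z)).1 hz
  · intro z
    obtain ⟨z, rfl⟩ := Submodule.Quotient.mk_surjective _ z
    exact ⟨Submodule.Quotient.mk z, rfl⟩
  · intro z
    obtain ⟨z, rfl⟩ := Submodule.Quotient.mk_surjective _ z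
    constructor
    · intro hz
      have : (z : M) ∈ B :=
        (Submodule.Quotient.mk_eq_zero (B.comap A.subtype) (x := z)).1 hz
      exact ⟨Submodule.Quotient.mk ⟨z, this⟩, rfl⟩
    · rintro ⟨w, hw⟩
      obtain ⟨w, rfl⟩ := Submodule.Quotient.mk_surjective _ w
      have h1 : Submodule.inclusion hBA w - z ∈ C.comap A.subtype :=
        (Submodule.Quotient.eq _).1 hw
      refine (Submodule.Quotient.mk_eq_zero _).2 ?_
      have h2 : (w : M) - z ∈ C := h1
      have := sub_mem w.2 (hCB h2)
      simpa using this

lemma ql_map {A B : Submodule R M} (φ : M →ₗ[R] M) (hφ : Function.Injective φ) :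
    ql (A.map φ) (B.map φ) = ql A B := by
  symm
  refine LinearEquiv.length_eq (Submodule.Quotient.equiv _ _
    (Submodule.equivMapOfInjective φ hφ A) ?_)
  ext z
  simp only [Submodule.mem_map, Submodule.mem_comap, Submodule.subtype_apply]
  constructor
  · rintro ⟨w, hw, rfl⟩
    exact ⟨w, hw, rfl⟩
  · rintro ⟨w, hw, e⟩
    obtain ⟨v, hv, e2⟩ := z.2
    have : w = v := hφ (e.trans e2.symm)
    subst this
    exact ⟨⟨w, hv⟩, hw, Subtype.ext e⟩

lemma ql_eq {E N : Submodule R M} (φ : M →ₗ[R] M) (hφ : Function.Injective φ) (hNE : N ≤ E)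
    (hE : E.map φ ≤ E) (hN : N.map φ ≤ N) (hfin : ql E N ≠ ⊤) :
    ql E (E.map φ) = ql N (N.map φ) := by
  have h1 := ql_add hE (Submodule.map_mono (f := φ) hNE)
  have h2 := ql_add hNE hN
  rw [ql_map φ hφ] at h1
  rw [h1, add_comm] at h2
  exact WithTop.add_right_cancel hfin h2

lemma length_le_aux (b : R) (hb : ∀ m : M, b • m = 0 → m = 0) (E0 : Submodule R M)
    (E : ℕ → Submodule R M) (hmono : Monotone E) (h0 : ∀ n, E0 ≤ E n) (hex : ∀ m, ∃ n, m ∈ E n)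
    (hfin : ∀ n, ql (E n) E0 ≠ ⊤) :
    Module.length R (M ⧸ LinearMap.range (LinearMap.lsmul R M b)) ≤
      ql E0 (E0.map (LinearMap.lsmul R M b)) := by
  set φ := LinearMap.lsmul R M b with hφ
  have hinj : Function.Injective φ := by
    rw [← LinearMap.ker_eq_bot, LinearMap.ker_eq_bot']
    intro m hm; exact hb m hm
  have hst : ∀ A : Submodule R M, A.map φ ≤ A := by
    rintro A _ ⟨m, hm, rfl⟩
    exact A.smul_mem b hm
  set L := ql E0 (E0.map φ) with hL
  by_cases hLt : L = ⊤
  · rw [hLt]; exact le_top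
  let img : ℕ → Submodule R (M ⧸ LinearMap.range φ) :=
    fun n => (E n).map (LinearMap.range φ).mkQ
  have hh : ∀ n, Order.height (img n) ≤ L := by
    intro n
    rw [← Module.length_submodule, hL, ← ql_eq φ hinj (h0 n) (hst _) (hst _) (hfin n)]
    let g : (E n) →ₗ[R] (img n) :=
      ((LinearMap.range φ).mkQ.comp (E n).subtype).codRestrict _ (fun c => ⟨c, c.2, rfl⟩)
    have hgs : Function.Surjective g := by
      rintro ⟨_, m, hm, rfl⟩
      exact ⟨⟨m, hm⟩, rfl⟩
    refine Module.length_le_of_surjective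
      (Submodule.liftQ ((Submodule.map φ (E n)).comap (E n).subtype) g ?_) ?_
    · rintro ⟨m, hm⟩ ⟨w, hw, hwm⟩
      rw [LinearMap.mem_ker]
      apply Subtype.ext
      change Submodule.Quotient.mk m = 0
      rw [Submodule.Quotient.mk_eq_zero]
      exact ⟨w, hwm⟩
    · intro z
      obtain ⟨m, rfl⟩ := hgs z
      exact ⟨Submodule.Quotient.mk m, rfl⟩
  have himono : Monotone img := fun i j hij => Submodule.map_mono (hmono hij)
  -- choose the maximum
  obtain ⟨L', hL'⟩ := ENat.ne_top_iff_exists.1 hLt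
  have hnat : ∀ n, ∃ k : ℕ, (k : ℕ∞) = Order.height (img n) ∧ k ≤ L' := by
    intro n
    have h1 : Order.height (img n) ≠ ⊤ := ne_top_of_le_ne_top hLt (hh n)
    obtain ⟨k, hk⟩ := ENat.ne_top_iff_exists.1 h1
    refine ⟨k, hk, ?_⟩
    have := hh n
    rw [← hk, ← hL'] at this
    exact_mod_cast this
  choose k hk hkL using hnat
  have hmax : ∃ n, ∀ m, k m ≤ k n := by
    have hbdd : BddAbove (Set.range k) := ⟨L', by rintro _ ⟨n, rfl⟩; exact hkL n⟩
    obtain ⟨n, hn⟩ := Nat.sSup_mem (Set.range_nonempty k) hbdd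
    exact ⟨n, fun m => by rw [hn]; exact le_csSup hbdd ⟨m, rfl⟩⟩
  obtain ⟨n, hn⟩ := hmax
  have hstab : ∀ m, img m ≤ img n := by
    intro m
    have h1 : img n ≤ img (max m n) := himono (le_max_right _ _)
    have h2 : img m ≤ img (max m n) := himono (le_max_left _ _)
    rcases h1.eq_or_lt with h3 | h3
    · rw [h3]; exact h2
    · exfalso
      have h4 := Order.height_strictMono h3 (by rw [← hk]; exact WithTop.coe_lt_top _)
      rw [← hk, ← hk] at h4
      have := hn (max m n)
      have h5 : k n < k (max m n) := by exact_mod_cast h4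
      omega
  have htop : img n = ⊤ := by
    rw [eq_top_iff]
    rintro z -
    obtain ⟨z, rfl⟩ := Submodule.Quotient.mk_surjective _ z
    obtain ⟨m, hm⟩ := hex z
    exact hstab m ⟨z, hm, rfl⟩
  rw [Module.length_eq_height, ← htop]
  exact hh n

end Length

section FinLen

variable {R M : Type*} [CommRing R] [IsNoetherianRing R] [IsLocalRing R] [AddCommGroup M] [Module R M]

lemma finlen_of_pow [Module.Finite R M] (k : ℕ) (h : ∀ r ∈ maximalIdeal R ^ k, ∀ m : M, r • m = 0) :
    Module.length R M ≠ ⊤ := by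
  rcases Nat.eq_zero_or_pos k with rfl | hk
  · have : Subsingleton M := ⟨fun p q => by
      have h1 := h 1 (by simp) p
      have h2 := h 1 (by simp) q
      rw [one_smul] at h1 h2; rw [h1, h2]⟩
    rw [Module.length_eq_zero]; simp
  set I := maximalIdeal R ^ k with hI
  have hIne : I ≠ ⊤ := by
    intro h1
    have : I ≤ maximalIdeal R := Ideal.pow_le_self (by omega)
    rw [h1] at this
    exact (maximalIdeal.isMaximal R).ne_top (top_le_iff.1 this)
  have : Nontrivial (R ⧸ I) := Ideal.Quotient.nontrivial_iff.2 hIne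
  have : IsLocalRing (R ⧸ I) := IsLocalRing.of_surjective' _ Ideal.Quotient.mk_surjective
  have hart : IsArtinianRing (R ⧸ I) := by
    rw [isArtinianRing_iff_isNilpotent_maximalIdeal]
    refine ⟨k, ?_⟩
    have e : maximalIdeal (R ⧸ I) ≤ (maximalIdeal R).map (Ideal.Quotient.mk I) := by
      intro z hz
      obtain ⟨z, rfl⟩ := Ideal.Quotient.mk_surjective z
      apply Ideal.mem_map_of_mem
      by_contra hn
      have hu : IsUnit z := by
        by_contra h; exact hn ((mem_maximalIdeal z).2 h)
      exact (mem_maximalIdeal _).1 hz (hu.map _)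
    rw [Ideal.zero_eq_bot, eq_bot_iff]
    refine (Ideal.pow_right_mono e k).trans ?_
    rw [← Ideal.map_pow, ← hI, Ideal.map_quotient_self]
  have hA : IsArtinian R (R ⧸ I) :=
    isArtinian_of_surjective_algebraMap (Ideal.Quotient.mk_surjective (I := I))
  have htor : Module.IsTorsionBySet R M I := fun m r => h r r.2 m
  let _ := htor.module
  have : IsScalarTower R (R ⧸ I) M := htor.isScalarTower
  have : Module.Finite (R ⧸ I) M := Module.Finite.of_restrictScalars_finite R (R ⧸ I) M
  have h1 : IsArtinian (R ⧸ I) M := inferInstance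
  have h2 : IsArtinian R M := isArtinian_of_surjective_algebraMap
    (Ideal.Quotient.mk_surjective (I := I))
  exact Module.length_ne_top

end FinLen

end Stmt19

open IsLocalRing

namespace Stmt19

section LengthDrop

variable {D D₁ : Type*} [CommRing D] [IsNoetherianRing D] [IsLocalRing D] [CommRing D₁]
  [IsDomain D₁] [Algebra D D₁] [FaithfulSMul D D₁]

lemma length_drop {x y a b c : D} (hm : maximalIdeal D = Ideal.span {x, y})
    {a' b' : D₁} {r i : ℕ} (hr : r ≠ 0) (hx0 : x ≠ 0)
    (hb : algebraMap D D₁ b = algebraMap D D₁ x ^ r * b')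
    (ha : a' ∣ algebraMap D D₁ a)
    (h1 : ∀ z : D₁, ∃ (n : ℕ) (d : D), algebraMap D D₁ x ^ n * z = algebraMap D D₁ d)
    (hrx : Rg a' (algebraMap D D₁ x)) (hrb : Rg a' b')
    (hc : y ^ i ∈ Ideal.span {x, c}) (hca : a' ∣ algebraMap D D₁ c)
    (hN : Ideal.span {algebraMap D D₁ x, a'} ≠ ⊤)
    (hfin : Order.coheight (Ideal.span {a, b} : Ideal D) ≠ ⊤) :
    Order.coheight ((Ideal.span {a', b'} : Ideal D₁).restrictScalars D) <
      Order.coheight (Ideal.span {a, b} : Ideal D) := by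
  have hinj : Function.Injective (algebraMap D D₁) := FaithfulSMul.algebraMap_injective D D₁
  have hxD : algebraMap D D₁ x ≠ 0 := by rwa [Ne, map_eq_zero_iff _ hinj]
  set A : Submodule D D₁ := (Ideal.span {a'} : Ideal D₁).restrictScalars D with hA
  have memA : ∀ z : D₁, z ∈ A ↔ a' ∣ z := fun z => by
    rw [hA, Submodule.restrictScalars_mem, Ideal.mem_span_singleton]
  set W0 : Submodule D D₁ := (Ideal.span {a', algebraMap D D₁ b} : Ideal D₁).restrictScalars D
    with hW0
  set W : Submodule D D₁ := (Ideal.span {a', b'} : Ideal D₁).restrictScalars D with hW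
  let M := D₁ ⧸ A
  let P : ℕ → Submodule D D₁ := fun n =>
    (LinearMap.range (Algebra.linearMap D D₁)).comap (LinearMap.lsmul D D₁ (x ^ n))
  have memP : ∀ n z, z ∈ P n ↔ ∃ d : D, algebraMap D D₁ d = algebraMap D D₁ x ^ n * z := by
    intro n z
    simp only [P, Submodule.mem_comap, LinearMap.mem_range, Algebra.linearMap_apply,
      LinearMap.lsmul_apply, Algebra.smul_def, map_pow]
  let E0 : Submodule D M := (LinearMap.range (Algebra.linearMap D D₁)).map A.mkQ
  let E : ℕ → Submodule D M := fun n => (P n).map A.mkQ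
  have hPmono : Monotone P := by
    refine monotone_nat_of_le_succ fun n z hz => ?_
    obtain ⟨d, hd⟩ := (memP _ _).1 hz
    refine (memP _ _).2 ⟨x * d, ?_⟩
    rw [map_mul, hd]; ring
  have hPfg : ∀ n, (P n).FG := by
    intro n
    have hi : Function.Injective (LinearMap.lsmul D D₁ (x ^ n)) := by
      intro u v huv
      simp only [LinearMap.lsmul_apply, Algebra.smul_def, map_pow] at huv
      exact mul_left_cancel₀ (pow_ne_zero _ hxD) huv
    have : IsNoetherian D (P n) := by
      have : IsNoetherian D (LinearMap.range (Algebra.linearMap D D₁)) := inferInstance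
      refine isNoetherian_of_injective (f := ((LinearMap.lsmul D D₁ (x ^ n)).restrict
        (p := P n) (q := LinearMap.range (Algebra.linearMap D D₁)) (fun z hz => hz))) ?_
      intro u v huv
      exact Subtype.ext (hi (congrArg Subtype.val huv))
    exact Module.Finite.iff_fg.1 inferInstance
  have h0 : ∀ n, E0 ≤ E n := by
    intro n
    refine Submodule.map_mono ?_
    rintro _ ⟨d, rfl⟩
    exact (memP _ _).2 ⟨x ^ n * d, by simp⟩
  have hbreg : ∀ m : M, b • m = 0 → m = 0 := by
    intro m hm0
    obtain ⟨z, rfl⟩ := Submodule.Quotient.mk_surjective _ m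
    rw [← Submodule.Quotient.mk_smul, Submodule.Quotient.mk_eq_zero, memA, Algebra.smul_def, hb]
      at hm0
    rw [Submodule.Quotient.mk_eq_zero, memA]
    obtain ⟨e, he⟩ := hm0
    obtain ⟨f, hf⟩ := hrx.pow r (b' * z) e (by rw [← he]; ring)
    exact hrb _ _ hf
  have hEfin : ∀ n, ql (E n) E0 ≠ ⊤ := by
    intro n
    have hk : ∃ k, maximalIdeal D ^ k ≤ Ideal.span {x ^ n, c} := by
      refine Ideal.exists_pow_le_of_le_radical_of_fg ?_ (IsNoetherian.noetherian _)
      have hx : x ∈ (Ideal.span {x ^ n, c}).radical :=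
        ⟨n, Ideal.subset_span (by simp)⟩
      rw [hm, Ideal.span_le]
      rintro z (rfl | rfl)
      · exact hx
      · refine Ideal.mem_radical_of_pow_mem (m := i) ?_
        have : Ideal.span {x, c} ≤ (Ideal.span {x ^ n, c}).radical := by
          rw [Ideal.span_le]
          rintro z (rfl | rfl)
          · exact hx
          · exact Ideal.le_radical (Ideal.subset_span (by simp))
        exact this hc
    obtain ⟨k, hk⟩ := hk
    have : Module.Finite D (E n) := Module.Finite.iff_fg.2 ((hPfg n).map _)
    refine finlen_of_pow k ?_
    intro s hs m
    obtain ⟨⟨_, z, hz, rfl⟩, rfl⟩ := Submodule.Quotient.mk_surjective _ m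
    rw [← Submodule.Quotient.mk_smul, Submodule.Quotient.mk_eq_zero]
    change s • A.mkQ z ∈ E0
    obtain ⟨p, q, rfl⟩ := Ideal.mem_span_pair.1 (hk hs)
    rw [add_smul]
    refine add_mem ?_ ?_
    · obtain ⟨d, hd⟩ := (memP _ _).1 hz
      refine ⟨algebraMap D D₁ (p * d), ⟨p * d, rfl⟩, ?_⟩
      rw [← map_smul, Algebra.smul_def, map_mul, hd]
      simp [mul_assoc]
      rfl
    · have : (q * c) • A.mkQ z = 0 := by
        rw [← map_smul, Submodule.mkQ_apply, Submodule.Quotient.mk_eq_zero, memA, Algebra.smul_def,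
          map_mul]
        exact ((hca.mul_left _).mul_right _)
      rw [this]; exact zero_mem _
  have key := length_le_aux b hbreg E0 E (fun i j h => Submodule.map_mono (hPmono h)) h0 (by
    intro m
    obtain ⟨z, rfl⟩ := Submodule.Quotient.mk_surjective _ m
    obtain ⟨n, d, hd⟩ := h1 z
    exact ⟨n, z, (memP _ _).2 ⟨d, hd.symm⟩, rfl⟩) hEfin
  have s1 : ql E0 (E0.map (LinearMap.lsmul D M b)) ≤
      Order.coheight (Ideal.span {a, b} : Ideal D) := by
    rw [← Module.length_quotient]
    let g : D →ₗ[D] E0 := (A.mkQ.comp (Algebra.linearMap D D₁)).codRestrict E0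
      (fun d => ⟨_, ⟨d, rfl⟩, rfl⟩)
    have hg : Function.Surjective g := by
      rintro ⟨_, _, ⟨d, rfl⟩, rfl⟩
      exact ⟨d, rfl⟩
    let B := ((E0.map (LinearMap.lsmul D M b)).comap E0.subtype)
    refine Module.length_le_of_surjective
      (Submodule.liftQ (Ideal.span {a, b}) (B.mkQ.comp g) ?_) ?_
    · rw [Ideal.span, Submodule.span_le]
      rintro z (rfl | rfl)
      · change B.mkQ (g z) = 0
        have : g z = 0 := by
          apply Subtype.ext
          change A.mkQ (algebraMap D D₁ z) = 0
          rw [Submodule.mkQ_apply, Submodule.Quotient.mk_eq_zero, memA]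
          exact ha
        rw [this, map_zero]
      · change B.mkQ (g z) = 0
        rw [Submodule.mkQ_apply, Submodule.Quotient.mk_eq_zero]
        refine ⟨A.mkQ 1, ⟨1, ⟨1, by simp⟩, rfl⟩, ?_⟩
        change z • A.mkQ 1 = A.mkQ (algebraMap D D₁ z)
        rw [← map_smul, Algebra.smul_def, mul_one]
    · intro z
      obtain ⟨z, rfl⟩ := Submodule.Quotient.mk_surjective _ z
      obtain ⟨d, rfl⟩ := hg z
      exact ⟨Submodule.Quotient.mk d, rfl⟩
  have s2 : Order.coheight W0 ≤
      Module.length D (M ⧸ LinearMap.range (LinearMap.lsmul D M b)) := by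
    rw [← Module.length_quotient]
    have hAW : A ≤ W0 := by
      intro z hz
      exact Ideal.span_mono (by simp) hz
    refine Module.length_le_of_surjective
      (Submodule.liftQ _ (Submodule.liftQ A W0.mkQ (by rwa [Submodule.ker_mkQ])) ?_) ?_
    · rintro _ ⟨m, rfl⟩
      obtain ⟨z, rfl⟩ := Submodule.Quotient.mk_surjective _ m
      change W0.mkQ (b • z) = 0
      rw [Submodule.mkQ_apply, Submodule.Quotient.mk_eq_zero, Algebra.smul_def]
      exact Ideal.mul_mem_right _ _ (Ideal.subset_span (by simp))
    · intro z
      obtain ⟨z, rfl⟩ := Submodule.Quotient.mk_surjective _ z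
      exact ⟨Submodule.Quotient.mk (Submodule.Quotient.mk z), rfl⟩
  have s3 : Order.coheight W0 ≤ Order.coheight (Ideal.span {a, b} : Ideal D) :=
    s2.trans (key.trans s1)
  have hlt : W0 < W := by
    refine lt_of_le_of_ne ?_ ?_
    · have : Ideal.span {a', algebraMap D D₁ b} ≤ Ideal.span {a', b'} := by
        rw [Ideal.span_le]
        rintro z (rfl | rfl)
        · exact Ideal.subset_span (by simp)
        · rw [SetLike.mem_coe, hb]
          exact Ideal.mul_mem_left _ _ (Ideal.subset_span (by simp))
      exact this
    · intro heq
      have hb' : b' ∈ W0 := by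
        rw [heq]; exact Ideal.subset_span (by simp)
      obtain ⟨p, q, hpq⟩ := Ideal.mem_span_pair.1 (show b' ∈ Ideal.span _ from hb')
      rw [hb] at hpq
      obtain ⟨k, hk⟩ := hrb (1 - q * algebraMap D D₁ x ^ r) p (by linear_combination -hpq)
      apply hN
      rw [Ideal.eq_top_iff_one, Ideal.mem_span_pair]
      obtain ⟨r', rfl⟩ := Nat.exists_eq_succ_of_ne_zero hr
      refine ⟨q * algebraMap D D₁ x ^ r', k, ?_⟩
      rw [pow_succ] at hk
      linear_combination -hk
  refine lt_of_lt_of_le (Order.coheight_strictAnti hlt ?_) s3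
  exact lt_of_le_of_lt (Order.coheight_anti hlt.le) (lt_of_le_of_lt s3 (lt_top_iff_ne_top.2 hfin))

end LengthDrop

end Stmt19

open IsLocalRing

namespace Stmt19

section Blow

variable {K : Type*} [Field K]

lemma normal_step {E : Subring K} {p : E} (hp : Prime p) (n : ℕ) :
    ∀ f : K, IsIntegral E f → (p : K) ^ n * f ∈ E → f ∈ E := by
  have hp0 : (p : K) ≠ 0 := fun h => hp.ne_zero (Subtype.ext h)
  induction n with
  | zero => intro f _ h; simpa using h
  | succ n ih =>
    intro f hf h
    have h1 : (p : K) * f ∈ E := by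
      refine ih _ (int_mul p.2 hf) ?_
      convert h using 1; ring
    set g : E := ⟨p * f, h1⟩ with hg
    obtain ⟨P, hP, hPe⟩ := hf
    have e1 : f ^ P.natDegree = - ∑ i ∈ Finset.range P.natDegree, (P.coeff i : K) * f ^ i := by
      rw [hP.as_sum] at hPe
      simp only [Polynomial.eval₂_add, Polynomial.eval₂_pow, Polynomial.eval₂_X,
        Polynomial.eval₂_finsetSum, Polynomial.eval₂_mul, Polynomial.eval₂_C] at hPe
      exact eq_neg_of_add_eq_zero_left hPe
    have e2 : g ^ P.natDegree = p * (- ∑ i ∈ Finset.range P.natDegree,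
        P.coeff i * p ^ (P.natDegree - i - 1) * g ^ i) := by
      apply Subtype.ext
      push_cast
      simp only [hg]
      rw [mul_pow, e1, mul_neg, mul_neg, Finset.mul_sum, Finset.mul_sum]
      congr 1
      refine Finset.sum_congr rfl fun i hi => ?_
      have hi' : i < P.natDegree := Finset.mem_range.1 hi
      obtain ⟨k, hk⟩ : ∃ k, P.natDegree = i + k + 1 := ⟨P.natDegree - i - 1, by omega⟩
      rw [hk]
      have : i + k + 1 - i - 1 = k := by omega
      rw [this]; ring
    have e3 : p ∣ g := hp.dvd_of_dvd_pow ⟨_, e2⟩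
    obtain ⟨z, hz⟩ := e3
    have : f = z := by
      have := congrArg Subtype.val hz
      simp only [hg] at this
      push_cast at this
      exact mul_left_cancel₀ hp0 this
    rw [this]; exact z.2

variable {D : Subring K} {x y : D}

lemma adj_noeth [IsNoetherianRing D] (t : K) : IsNoetherianRing (adj D t) :=
  isNoetherianRing_of_surjective _ _ (Polynomial.eval₂RingHom D.subtype t).rangeRestrict
    (RingHom.rangeRestrict_surjective _)

lemma adj_den (hx0 : x ≠ 0) {z : K} (hz : z ∈ adj D ((y : K) / x)) :
    ∃ n : ℕ, (x : K) ^ n * z ∈ D := by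
  obtain ⟨F, rfl⟩ := mem_adj.1 hz
  have hx0' : algebraMap D K x ≠ 0 := fun h => hx0 (Subtype.ext h)
  obtain ⟨e, -, he⟩ := clear_den (K := K) (b := y) hx0' F.natDegree F le_rfl
  refine ⟨F.natDegree, ?_⟩
  have := e.2
  have h2 : (e : K) = algebraMap D K e := rfl
  rw [h2, he] at this
  exact this

lemma laurent {t : K} (ht : t ≠ 0) (k : ℕ) : ∀ z ∈ adj D t, ∃ r ∈ adj D t,
    t⁻¹ ^ k * z - r ∈ adj D t⁻¹ := by
  induction k with
  | zero => intro z hz; exact ⟨z, hz, by simp⟩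
  | succ k ih =>
    intro z hz
    obtain ⟨F, rfl⟩ := mem_adj.1 hz
    obtain ⟨r, hr, h⟩ := ih (F.divX.eval₂ D.subtype t) (mem_adj.2 ⟨_, rfl⟩)
    refine ⟨r, hr, ?_⟩
    have e : F.eval₂ D.subtype t = F.divX.eval₂ D.subtype t * t + F.coeff 0 := by
      conv_lhs => rw [← F.divX_mul_X_add]
      simp
    have := add_mem h (mul_mem (le_adj D t⁻¹ (F.coeff 0).2) (pow_mem (self_mem_adj D t⁻¹) (k + 1)))
    convert this using 1
    rw [e, pow_succ]
    linear_combination (t⁻¹ ^ k * Polynomial.eval₂ D.subtype t F.divX) * inv_mul_cancel₀ ht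

variable [IsLocalRing D]

lemma adj_coeff_mem (hm : maximalIdeal D = Ideal.span {x, y}) (hx : Prime x) (hxy : ¬ x ∣ y)
    {F G : Polynomial D}
    (h : F.eval₂ D.subtype ((y : K) / x) = x * G.eval₂ D.subtype ((y : K) / x)) (i : ℕ) :
    F.coeff i ∈ maximalIdeal D := by
  have hrg : Rg x y := fun c e hce =>
    (hx.dvd_or_dvd ⟨e, hce⟩).resolve_left hxy
  have h1 := coeff_mem_of_aeval_eq_zero (K := K) hx.ne_zero hrg _ (F - Polynomial.C x * G) le_rfl
    (by
      change Polynomial.eval₂ D.subtype ((y : K) / x) _ = 0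
      rw [Polynomial.eval₂_sub, Polynomial.eval₂_mul, Polynomial.eval₂_C, h]
      exact sub_self _) i
  rw [Polynomial.coeff_sub, Polynomial.coeff_C_mul, ← hm] at h1
  have h2 : x * G.coeff i ∈ maximalIdeal D := by
    rw [hm]; exact Ideal.mul_mem_right _ _ (Ideal.subset_span (by simp))
  have := add_mem h1 h2
  rwa [sub_add_cancel] at this

lemma adj_dvd (hm : maximalIdeal D = Ideal.span {x, y}) (hx0 : x ≠ 0)
    {F : Polynomial D} (h : ∀ i, F.coeff i ∈ maximalIdeal D) :
    ∃ G : Polynomial D, F.eval₂ D.subtype ((y : K) / x) = x * G.eval₂ D.subtype ((y : K) / x) := by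
  have hx0' : (x : K) ≠ 0 := fun h => hx0 (Subtype.ext h)
  have h1 : F ∈ Ideal.map Polynomial.C (maximalIdeal D) := Ideal.mem_map_C_iff.2 h
  rw [hm, Ideal.map_span, Set.image_pair, Ideal.mem_span_pair] at h1
  obtain ⟨p, q, rfl⟩ := h1
  refine ⟨p + q * Polynomial.X, ?_⟩
  simp only [Polynomial.eval₂_add, Polynomial.eval₂_mul, Polynomial.eval₂_C, Polynomial.eval₂_X,
    Subring.subtype_apply]
  field_simp

lemma adj_prime (hm : maximalIdeal D = Ideal.span {x, y}) (hx : Prime x) (hxy : ¬ x ∣ y) :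
    Prime (⟨x, le_adj D _ x.2⟩ : adj D ((y : K) / x)) := by
  have key : ∀ F : Polynomial D,
      (⟨x, le_adj D _ x.2⟩ : adj D ((y : K) / x)) ∣
        ⟨F.eval₂ D.subtype ((y : K) / x), mem_adj.2 ⟨F, rfl⟩⟩ ↔
      F ∈ Ideal.map Polynomial.C (maximalIdeal D) := by
    intro F
    rw [Ideal.mem_map_C_iff]
    constructor
    · rintro ⟨⟨z, hz⟩, h⟩ i
      obtain ⟨G, rfl⟩ := mem_adj.1 hz
      exact adj_coeff_mem hm hx hxy (congrArg Subtype.val h) i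
    · intro h
      obtain ⟨G, hG⟩ := adj_dvd hm hx.ne_zero h
      exact ⟨⟨_, mem_adj.2 ⟨G, rfl⟩⟩, Subtype.ext hG⟩
  have hpr : (Ideal.map Polynomial.C (maximalIdeal D)).IsPrime :=
    Ideal.isPrime_map_C_of_isPrime
  refine ⟨?_, ?_, ?_⟩
  · intro h
    have h' : (x : K) = 0 := congrArg Subtype.val h
    exact hx.ne_zero (Subtype.ext h')
  · intro h
    have h1 : (⟨x, le_adj D _ x.2⟩ : adj D ((y : K) / x)) ∣
        ⟨(1 : Polynomial D).eval₂ D.subtype ((y : K) / x), mem_adj.2 ⟨1, rfl⟩⟩ := h.dvd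
    rw [key] at h1
    exact (Ideal.ne_top_iff_one _).1 hpr.ne_top h1
  · rintro ⟨z, hz⟩ ⟨w, hw⟩ h
    obtain ⟨F, rfl⟩ := mem_adj.1 hz
    obtain ⟨G, rfl⟩ := mem_adj.1 hw
    rw [key, key]
    apply hpr.mem_or_mem
    rw [← key]
    convert h using 1
    apply Subtype.ext
    exact Polynomial.eval₂_mul _ _

lemma adj_normal (hn : ∀ f : K, IsIntegral D f → f ∈ D)
    (hm : maximalIdeal D = Ideal.span {x, y}) (hx : Prime x) (hxy : ¬ x ∣ y)
    (f : K) (hf : IsIntegral (adj D ((y : K) / x)) f) : f ∈ adj D ((y : K) / x) := by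
  obtain ⟨_, ⟨n, rfl⟩, hs⟩ := integral_scale (E := D) (Submonoid.powers (x : K))
    (by rintro _ ⟨n, rfl⟩; exact pow_mem x.2 n) (fun e he => by
      obtain ⟨n, hn⟩ := adj_den hx.ne_zero he
      exact ⟨_, ⟨n, rfl⟩, hn⟩) hf
  exact normal_step (adj_prime hm hx hxy) n f hf (le_adj D _ (hn _ hs))

lemma h12_blow (hn : ∀ f : K, IsIntegral D f → f ∈ D)
    (hm : maximalIdeal D = Ideal.span {x, y}) (hx : Prime x) (hxy : ¬ x ∣ y) (δ : K)
    (h : ∀ V : ValuationSubring K, D ≤ V.toSubring → (y : K) / x ∈ V → ((y : K) / x)⁻¹ ∈ V → δ ∈ V) :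
    ∃ r ∈ adj D ((y : K) / x), δ - r ∈ adj D ((y : K) / x)⁻¹ := by
  have hx0' : (x : K) ≠ 0 := fun h => hx.ne_zero (Subtype.ext h)
  have hy0' : (y : K) ≠ 0 := fun h => hxy (by
    have : y = 0 := Subtype.ext h
    rw [this]; exact dvd_zero _)
  set t := (y : K) / x with ht
  have ht0 : t ≠ 0 := div_ne_zero hy0' hx0'
  have h1 : IsIntegral (adj (adj D t) t⁻¹) δ := by
    rw [cl_adj_iff]
    intro V hV ht'
    rw [adj_le_iff] at hV
    exact h V hV.1 hV.2 ht'
  obtain ⟨_, ⟨n, rfl⟩, hs⟩ := integral_scale (E := adj D t) (Submonoid.powers t)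
    (by rintro _ ⟨n, rfl⟩; exact pow_mem (self_mem_adj D t) n) (fun e he => by
      obtain ⟨F, rfl⟩ := mem_adj.1 he
      refine ⟨_, ⟨F.natDegree, rfl⟩, ?_⟩
      simp only
      rw [Polynomial.eval₂_eq_sum_range, Finset.mul_sum]
      refine sum_mem fun i hi => ?_
      have hi' : i ≤ F.natDegree := by simpa [Nat.lt_succ_iff] using hi
      obtain ⟨k, hk⟩ := Nat.exists_eq_add_of_le hi'
      have e : t ^ F.natDegree * ((adj D t).subtype (F.coeff i) * t⁻¹ ^ i)
        = (F.coeff i : K) * t ^ k := by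
        rw [hk, pow_add]
        simp only [Subring.subtype_apply]
        have : t ^ i * t⁻¹ ^ i = 1 := by rw [← mul_pow, mul_inv_cancel₀ ht0, one_pow]
        linear_combination ((F.coeff i : K) * t ^ k) * this
      rw [e]
      exact mul_mem (F.coeff i).2 (pow_mem (self_mem_adj D t) _)) h1
  have h2 := adj_normal hn hm hx hxy _ hs
  obtain ⟨r, hr, h3⟩ := laurent ht0 n _ h2
  refine ⟨r, hr, ?_⟩
  have : t⁻¹ ^ n * t ^ n = 1 := by rw [← mul_pow, inv_mul_cancel₀ ht0, one_pow]
  have e : t⁻¹ ^ n * (t ^ n * δ) = δ := by rw [← mul_assoc, this, one_mul]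
  rw [← e]
  exact h3

lemma adj_max (hm : maximalIdeal D = Ideal.span {x, y}) (hx0 : x ≠ 0)
    (N : Ideal (adj D ((y : K) / x)))
    (hxN : (⟨x, le_adj D _ x.2⟩ : adj D ((y : K) / x)) ∈ N) :
    ∃ g, N = Ideal.span {(⟨x, le_adj D _ x.2⟩ : adj D ((y : K) / x)), g} := by
  set X : adj D ((y : K) / x) := ⟨x, le_adj D _ x.2⟩ with hX
  let φ : Polynomial D →+* adj D ((y : K) / x) :=
    (Polynomial.eval₂RingHom D.subtype ((y : K) / x)).rangeRestrict
  have hφ : Function.Surjective φ := RingHom.rangeRestrict_surjective _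
  let ρ := Polynomial.mapRingHom (residue D)
  have hρ : Function.Surjective ρ := Polynomial.map_surjective _ residue_surjective
  have hker : ∀ F, ρ F = 0 → X ∣ φ F := by
    intro F hF
    obtain ⟨G, hG⟩ := adj_dvd (K := K) (F := F) hm hx0 (by
      intro i
      have := congrArg (fun q => Polynomial.coeff q i) hF
      simp only [ρ, Polynomial.coe_mapRingHom, Polynomial.coeff_map, Polynomial.coeff_zero] at this
      exact (residue_eq_zero_iff _).1 this)
    exact ⟨φ G, Subtype.ext hG⟩
  obtain ⟨γ, hγ⟩ := (IsPrincipalIdealRing.principal ((N.comap φ).map ρ)).principal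
  obtain ⟨g, rfl⟩ := hρ γ
  rw [← Ideal.span] at hγ
  refine ⟨φ g, le_antisymm ?_ ?_⟩
  · intro z hz
    obtain ⟨F, rfl⟩ := hφ z
    have h1 : ρ F ∈ (N.comap φ).map ρ := Ideal.mem_map_of_mem _ hz
    rw [hγ, Ideal.mem_span_singleton] at h1
    obtain ⟨h, hh⟩ := h1
    obtain ⟨h, rfl⟩ := hρ h
    obtain ⟨w, hw⟩ := hker (F - g * h) (by rw [map_sub, map_mul, hh, sub_self])
    rw [Ideal.mem_span_pair]
    refine ⟨w, φ h, ?_⟩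
    rw [map_sub, map_mul] at hw
    linear_combination -hw
  · rw [Ideal.span_le]
    rintro z (rfl | rfl)
    · exact hxN
    · have h1 : ρ g ∈ (N.comap φ).map ρ := by
        rw [hγ]; exact Ideal.mem_span_singleton_self _
      obtain ⟨F, hF, e⟩ := (Ideal.mem_map_iff_of_surjective ρ hρ).1 h1
      obtain ⟨w, hw⟩ := hker (g - F) (by rw [map_sub, e, sub_self])
      rw [map_sub] at hw
      have : φ g = X * w + φ F := by linear_combination hw
      rw [SetLike.mem_coe, this]
      exact add_mem (Ideal.mul_mem_right _ _ hxN) hF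

end Blow

end Stmt19

open IsLocalRing

namespace Stmt19

section Main

variable {K : Type*} [Field K]

/-- Two-dimensional regular local subrings. -/
structure Good (D : Subring K) (x y : D) : Prop where
  [noeth : IsNoetherianRing D]
  [loc : IsLocalRing D]
  normal : ∀ f : K, IsIntegral D f → f ∈ D
  hm : maximalIdeal D = Ideal.span {x, y}
  px : Prime x
  py : Prime y
  nd : ¬ x ∣ y

lemma Good.symm {D : Subring K} {x y : D} (h : Good D x y) : Good D y x := by
  have := h.noeth
  have := h.loc
  refine ⟨h.normal, ?_, h.py, h.px, fun h1 => h.nd ?_⟩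
  · rw [h.hm, Set.pair_comm]
  · obtain ⟨c, hc⟩ := h1
    have h2 : x ∣ y * c := ⟨1, by rw [← hc, mul_one]⟩
    rcases h.px.dvd_or_dvd h2 with h3 | ⟨d, hd⟩
    · exact h3
    · exfalso
      apply h.py.not_isUnit
      refine IsUnit.of_mul_eq_one d ?_
      apply mul_left_cancel₀ h.px.ne_zero
      rw [mul_one]
      conv_rhs => rw [hc, hd]
      ring

lemma dvd_loc {E : Subring K} {X : E} (hX : Prime X) {N : Ideal E} [N.IsMaximal] (hXN : X ∈ N)
    {z : E} (h : algebraMap E (LocalSubring.ofPrime E N).toSubring X ∣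
      algebraMap E (LocalSubring.ofPrime E N).toSubring z) : X ∣ z := by
  obtain ⟨w, hw⟩ := h
  obtain ⟨s, hs, hsw⟩ := mem_ofPrime.1 w.2
  have hw' : (z : K) = X * w := congrArg Subtype.val hw
  have h1 : X ∣ s * z := ⟨⟨_, hsw⟩, Subtype.ext (by push_cast; rw [hw']; ring)⟩
  rcases hX.dvd_or_dvd h1 with ⟨v, hv⟩ | h2
  · exfalso; apply hs; rw [hv]; exact Ideal.mul_mem_right _ _ hXN
  · exact h2

lemma good_loc {E : Subring K} [IsNoetherianRing E] (hn : ∀ f : K, IsIntegral E f → f ∈ E)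
    {X g : E} (hX : Prime X) (N : Ideal E) [N.IsMaximal] (hN : N = Ideal.span {X, g})
    (hz : ∃ z ∈ N, ¬ X ∣ z) :
    ∃ x' y', Good (LocalSubring.ofPrime E N).toSubring x' y' := by
  set L := (LocalSubring.ofPrime E N).toSubring with hL
  have : IsLocalRing L := (LocalSubring.ofPrime E N).isLocalRing
  have hloc : IsLocalization.AtPrime L N := inferInstance
  have hnoe : IsNoetherianRing L := IsLocalization.isNoetherianRing N.primeCompl L inferInstance
  have hXN : X ∈ N := by rw [hN]; exact Ideal.subset_span (by simp)
  set x' := algebraMap E L X with hx'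
  set y' := algebraMap E L g with hy'
  have hm : maximalIdeal L = Ideal.span {x', y'} := by
    rw [← IsLocalization.AtPrime.map_eq_maximalIdeal N L]
    refine (congrArg (Ideal.map (algebraMap E L)) hN).trans ?_
    rw [Ideal.map_span, Set.image_pair]
  have hnd : ¬ x' ∣ y' := by
    intro h
    obtain ⟨z, hzN, hz⟩ := hz
    apply hz
    apply dvd_loc hX hXN
    have h1 : algebraMap E L z ∈ N.map (algebraMap E L) := Ideal.mem_map_of_mem _ hzN
    rw [IsLocalization.AtPrime.map_eq_maximalIdeal N L, hm, Ideal.mem_span_pair] at h1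
    obtain ⟨p, q, e⟩ := h1
    change x' ∣ algebraMap E L z
    rw [← e]
    exact dvd_add (dvd_mul_left _ _) (h.mul_left _)
  have hx0 : x' ≠ 0 := by
    intro h
    exact hX.ne_zero (Subtype.ext (congrArg Subtype.val h : ((X : K) = 0)))
  have hpx : Prime x' := by
    rw [← Ideal.span_singleton_prime hx0]
    have h1 : (Ideal.span {X}).IsPrime := (Ideal.span_singleton_prime hX.ne_zero).2 hX
    have h2 := IsLocalization.isPrime_of_isPrime_disjoint N.primeCompl L (Ideal.span {X}) h1 (by
      rw [Set.disjoint_left]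
      intro s hs hs2
      exact hs ((Ideal.span_singleton_le_iff_mem _).2 hXN hs2))
    rwa [Ideal.map_span, Set.image_singleton] at h2
  have hy0 : y' ≠ 0 := by
    intro h; apply hnd; rw [h]; exact dvd_zero _
  refine ⟨x', y', ?_, hm, hpx, ?_, hnd⟩
  · intro f hf
    obtain ⟨s, ⟨w, hw, e⟩, h1⟩ := integral_scale (E := E) (N.primeCompl.map E.subtype)
      (by rintro _ ⟨w, _, rfl⟩; exact w.2) (fun e he => by
        obtain ⟨s, hs, h2⟩ := mem_ofPrime.1 he
        exact ⟨s, ⟨s, hs, rfl⟩, h2⟩) hf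
    refine mem_ofPrime.2 ⟨w, hw, ?_⟩
    rw [← e] at h1
    exact hn _ h1
  · refine prime_of_not_dvd_pow hy0 (by rw [hm, Set.pair_comm]) ?_
    have hyu : ¬ IsUnit y' := by
      rw [← mem_nonunits_iff, ← mem_maximalIdeal, hm]
      exact Ideal.subset_span (by simp)
    intro n
    induction n with
    | zero => rw [pow_zero]; exact fun h => hyu (isUnit_of_dvd_one h)
    | succ n ih =>
      rintro ⟨e, he⟩
      have h1 : x' ∣ y' * e := ⟨x' ^ n, by rw [← he]; ring⟩
      obtain ⟨e', rfl⟩ := (hpx.dvd_or_dvd h1).resolve_left hnd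
      apply ih
      refine ⟨e', mul_left_cancel₀ hx0 ?_⟩
      rw [pow_succ] at he
      linear_combination he

lemma pow_mem_of_fin {D : Type*} [CommRing D] [IsLocalRing D] {Q : Ideal D}
    (h : Order.coheight Q ≠ ⊤) {x : D} (hx : x ∈ maximalIdeal D) : ∃ k : ℕ, x ^ k ∈ Q := by
  rw [← Module.length_quotient] at h
  have hfl : IsFiniteLength D (D ⧸ Q) := Module.length_ne_top_iff.1 h
  have : IsArtinian D (D ⧸ Q) := (isFiniteLength_iff_isNoetherian_isArtinian.1 hfl).2
  obtain ⟨n, z, hz⟩ := IsArtinian.exists_pow_succ_smul_dvd x (1 : D ⧸ Q)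
  obtain ⟨z, rfl⟩ := Ideal.Quotient.mk_surjective z
  refine ⟨n, ?_⟩
  have h1 : x ^ n.succ * z - x ^ n * 1 ∈ Q := by
    rw [← Ideal.Quotient.eq]
    rw [Algebra.smul_def, Algebra.smul_def] at hz
    simpa using hz
  have hu : IsUnit (1 - x * z) := by
    have h3 : x * z ∈ maximalIdeal D := Ideal.mul_mem_right _ _ hx
    exact isUnit_one_sub_self_of_mem_nonunits _ ((mem_maximalIdeal _).1 h3)
  have h2 : x ^ n * (1 - x * z) ∈ Q := by
    have := neg_mem h1
    convert this using 1
    rw [pow_succ]; ring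
  exact (Ideal.unit_mul_mem_iff_mem Q hu).1 (by rwa [mul_comm] at h2)

lemma chart_aux {D : Subring K} {x y : D} (hD : Good D x y) {a b : D} (ha0 : a ≠ 0) (hb0 : b ≠ 0)
    (hab : Rg a b) (hfin : Order.coheight (Ideal.span {a, b} : Ideal D) ≠ ⊤)
    (ih : ∀ (D' : Subring K) (x' y' : D'), Good D' x' y' → ∀ a' b' : D', a' ≠ 0 → b' ≠ 0 →
      Rg a' b' → Order.coheight (Ideal.span {a', b'} : Ideal D') <
        Order.coheight (Ideal.span {a, b} : Ideal D) → Pp D' ((b' : K) / a'))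
    {E : Subring K} (hE : E = adj D ((y : K) / x)) (hDE : D ≤ E)
    {a' b' : E} {r : ℕ} (hr : r ≠ 0)
    (ha : (a : K) = (x : K) ^ r * a') (hb : (b : K) = (x : K) ^ r * b')
    (hnd : ¬ (⟨x, hDE x.2⟩ : E) ∣ a') :
    Pp E ((b : K) / a) := by
  have := hD.noeth
  have := hD.loc
  have hx0 : (x : K) ≠ 0 := fun h => hD.px.ne_zero (Subtype.ext h)
  have hT : (b : K) / a = (b' : K) / a' := by
    rw [ha, hb, mul_div_mul_left _ _ (pow_ne_zero _ hx0)]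
  set X : E := ⟨x, hDE x.2⟩ with hX
  have hXp : Prime X := by subst hE; exact adj_prime hD.hm hD.px hD.nd
  have hEn : IsNoetherianRing E := by subst hE; exact adj_noeth _
  have hnorm : ∀ f : K, IsIntegral E f → f ∈ E := by
    subst hE; exact adj_normal hD.normal hD.hm hD.px hD.nd
  let _ : Algebra D E := (Subring.inclusion hDE).toAlgebra
  have hfs : FaithfulSMul D E := by
    rw [faithfulSMul_iff_algebraMap_injective]
    exact Subring.inclusion_injective _
  have hXe : algebraMap D E x = X := rfl
  have haE : algebraMap D E a = X ^ r * a' := Subtype.ext ha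
  have hbE : algebraMap D E b = X ^ r * b' := Subtype.ext hb
  have ha'0 : a' ≠ 0 := by rintro rfl; exact hnd (dvd_zero _)
  have hb'0 : b' ≠ 0 := by
    rintro rfl
    apply hb0; apply Subtype.ext; rw [hb]; simp
  have h1 : ∀ z : E, ∃ (n : ℕ) (d : D), algebraMap D E x ^ n * z = algebraMap D E d := by
    intro z
    obtain ⟨n, hn⟩ := adj_den hD.px.ne_zero (hE ▸ z.2 : (z : K) ∈ adj D ((y : K) / x))
    exact ⟨n, ⟨_, hn⟩, Subtype.ext rfl⟩
  have hrx : Rg a' X := by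
    intro c e h
    obtain ⟨e', rfl⟩ := (hXp.dvd_or_dvd ⟨c, h.symm⟩).resolve_left hnd
    refine ⟨e', mul_left_cancel₀ hXp.ne_zero ?_⟩
    rw [h]; ring
  have hrb : Rg a' b' := by
    intro c e h
    obtain ⟨n1, c', hc'⟩ := h1 c
    obtain ⟨n2, e', he'⟩ := h1 e
    rw [hXe] at hc' he'
    have h2 : b * (x ^ n2 * c') = a * (x ^ n1 * e') := by
      apply FaithfulSMul.algebraMap_injective D E
      simp only [map_mul, map_pow, haE, hbE, hXe, ← hc', ← he']
      linear_combination (X ^ r * X ^ n1 * X ^ n2) * h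
    obtain ⟨k, hk⟩ := hab _ _ h2
    have hk' := congrArg (algebraMap D E) hk
    simp only [map_mul, map_pow, haE, hXe, ← hc'] at hk'
    exact hrx.pow (n1 + n2) c (X ^ r * algebraMap D E k) (by rw [pow_add]; linear_combination hk')
  rw [hT]
  refine Pp_local fun N _ => ?_
  have hEL := LocalSubring.le_ofPrime E N
  by_cases haN : a' ∈ N
  swap
  · refine Pp_of_mem (mem_ofPrime.2 ⟨a', haN, ?_⟩)
    have : (a' : K) ≠ 0 := fun h => ha'0 (Subtype.ext h)
    rw [mul_div_cancel₀ _ this]; exact b'.2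
  by_cases hbN : b' ∈ N
  swap
  · refine Pp_of_inv_mem (mem_ofPrime.2 ⟨b', hbN, ?_⟩)
    have : (b' : K) ≠ 0 := fun h => hb'0 (Subtype.ext h)
    rw [inv_div, mul_div_cancel₀ _ this]; exact a'.2
  have hxm : x ∈ maximalIdeal D := by rw [hD.hm]; exact Ideal.subset_span (by simp)
  have hXN : X ∈ N := by
    obtain ⟨k, hk⟩ := pow_mem_of_fin hfin hxm
    obtain ⟨p, q, hpq⟩ := Ideal.mem_span_pair.1 hk
    have h2 := congrArg (algebraMap D E) hpq
    rw [map_add, map_mul, map_mul, map_pow, haE, hbE, hXe] at h2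
    have hN : N.IsPrime := inferInstance
    refine hN.mem_of_pow_mem k ?_
    rw [← h2]
    exact add_mem (Ideal.mul_mem_left _ _ (Ideal.mul_mem_left _ _ haN))
      (Ideal.mul_mem_left _ _ (Ideal.mul_mem_left _ _ hbN))
  obtain ⟨g, hg⟩ : ∃ g, N = Ideal.span {X, g} := by
    subst hE; exact adj_max hD.hm hD.px.ne_zero N hXN
  obtain ⟨x', y', hgood⟩ := good_loc hnorm hXp N hg ⟨a', haN, hnd⟩
  -- the drop
  have hdrop : Order.coheight ((Ideal.span {a', b'} : Ideal E).restrictScalars D) <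
      Order.coheight (Ideal.span {a, b} : Ideal D) := by
    obtain ⟨j, c, hc, hjc⟩ : ∃ (j : ℕ) (c : D), ¬ x ∣ c ∧ a = x ^ j * c := by
      obtain ⟨c, h1, h2⟩ := (FiniteMultiplicity.of_not_isUnit hD.px.not_isUnit
        ha0).exists_eq_pow_mul_and_not_dvd
      exact ⟨_, c, h2, h1⟩
    obtain ⟨i, u, hu, hdv⟩ := dvr_form hD.hm hc
    have hyi : y ^ i ∈ Ideal.span {x, c} := by
      obtain ⟨w, hw⟩ := hdv
      rw [← Ideal.unit_mul_mem_iff_mem _ hu, Ideal.mem_span_pair]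
      exact ⟨-w, 1, by linear_combination hw⟩
    have hca : a' ∣ algebraMap D E c := by
      have h2 := congrArg (algebraMap D E) hjc
      rw [haE, map_mul, map_pow, hXe] at h2
      rcases le_or_gt j r with hjr | hjr
      · obtain ⟨l, rfl⟩ := Nat.exists_eq_add_of_le hjr
        refine ⟨X ^ l, mul_left_cancel₀ (pow_ne_zero j hXp.ne_zero) ?_⟩
        rw [← h2]; ring
      · exfalso
        obtain ⟨l, rfl⟩ := Nat.exists_eq_add_of_lt hjr
        apply hnd
        refine ⟨X ^ l * algebraMap D E c, mul_left_cancel₀ (pow_ne_zero r hXp.ne_zero) ?_⟩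
        rw [h2]; ring
    refine length_drop hD.hm hr hD.px.ne_zero hbE ⟨X ^ r, by rw [haE, mul_comm]⟩ h1 hrx hrb hyi hca
      ?_ hfin
    intro htop
    have hN : N ≠ ⊤ := Ideal.IsMaximal.ne_top inferInstance
    apply hN
    rw [eq_top_iff, ← htop, Ideal.span_le]
    rintro z (rfl | rfl)
    · exact hXN
    · exact haN
  let L := (LocalSubring.ofPrime E N).toSubring
  have hloc : IsLocalization.AtPrime L N := inferInstance
  set aL := algebraMap E L a' with haL
  set bL := algebraMap E L b' with hbL
  have haL0 : aL ≠ 0 := fun h => ha'0 (Subtype.ext (congrArg Subtype.val h : ((a' : K) = 0)))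
  have hbL0 : bL ≠ 0 := fun h => hb'0 (Subtype.ext (congrArg Subtype.val h : ((b' : K) = 0)))
  refine ih L x' y' hgood aL bL haL0 hbL0 ?_ (lt_of_le_of_lt ?_ hdrop)
  · intro c e h
    have hK : (b' : K) * c = a' * e := congrArg Subtype.val h
    obtain ⟨s, hs, hsc⟩ := mem_ofPrime.1 c.2
    obtain ⟨s', hs', hse⟩ := mem_ofPrime.1 e.2
    obtain ⟨k, hk⟩ := hrb (s' * ⟨_, hsc⟩) (s * ⟨_, hse⟩) (Subtype.ext (by
      push_cast
      linear_combination (s * s' : K) * hK))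
    have hkK : (s' : K) * (s * c) = a' * k := congrArg Subtype.val hk
    have hss : s' * s ∉ N := by
      have hNp : N.IsPrime := inferInstance
      intro h
      rcases hNp.mem_or_mem h with h | h
      · exact hs' h
      · exact hs h
    have hu : IsUnit (algebraMap E L (s' * s)) :=
      IsLocalization.map_units (M := N.primeCompl) L ⟨s' * s, hss⟩
    rw [← hu.dvd_mul_left]
    refine ⟨algebraMap E L k, Subtype.ext ?_⟩
    change ((s' : K) * s) * c = a' * k
    rw [← hkK]; ring
  · let f : Ideal L → Submodule D E := fun J => (J.comap (algebraMap E L)).restrictScalars D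
    have hf : StrictMono f := by
      refine Monotone.strictMono_of_injective ?_ ?_
      · intro J J' hJ
        exact Ideal.comap_mono (f := algebraMap E L) hJ
      · intro J J' hJ
        have : J.under E = J'.under E := by
          ext z
          exact SetLike.ext_iff.1 hJ z
        rw [← IsLocalization.map_under N.primeCompl L J, this,
          IsLocalization.map_under N.primeCompl L J']
    refine (Order.coheight_le_coheight_apply_of_strictMono f hf _).trans
      (Order.coheight_anti ?_)
    have : Ideal.span {a', b'} ≤ (Ideal.span {aL, bL}).comap (algebraMap E L) := by
      rw [Ideal.span_le]
      rintro z (rfl | rfl)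
      · exact Ideal.subset_span (by simp [haL])
      · exact Ideal.subset_span (by simp [hbL])
    exact this

lemma chart {D : Subring K} {x y : D} (hD : Good D x y) {a b : D} (ha0 : a ≠ 0) (hb0 : b ≠ 0)
    (hab : Rg a b) (hfin : Order.coheight (Ideal.span {a, b} : Ideal D) ≠ ⊤)
    (hne : (Ideal.span {a, b} : Ideal D) ≠ ⊤)
    (ih : ∀ (D' : Subring K) (x' y' : D'), Good D' x' y' → ∀ a' b' : D', a' ≠ 0 → b' ≠ 0 →
      Rg a' b' → Order.coheight (Ideal.span {a', b'} : Ideal D') <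
        Order.coheight (Ideal.span {a, b} : Ideal D) → Pp D' ((b' : K) / a')) :
    Pp (adj D ((y : K) / x)) ((b : K) / a) := by
  have := hD.noeth
  have := hD.loc
  set E := adj D ((y : K) / x) with hE
  set X : E := ⟨x, le_adj D _ x.2⟩ with hX
  have hXp : Prime X := adj_prime hD.hm hD.px hD.nd
  have hEn : IsNoetherianRing E := adj_noeth _
  have hfac : ∀ c : D, c ≠ 0 → c ∈ maximalIdeal D → ∃ (p : ℕ) (c' : E), p ≠ 0 ∧ ¬ X ∣ c' ∧
      (c : K) = (x : K) ^ p * c' := by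
    intro c hc0 hcm
    let cE : E := ⟨c, le_adj D _ c.2⟩
    have hcE0 : cE ≠ 0 := fun h => hc0 (Subtype.ext (congrArg Subtype.val h : ((c : K) = 0)))
    obtain ⟨c', h1, h2⟩ := (FiniteMultiplicity.of_not_isUnit hXp.not_isUnit
      hcE0).exists_eq_pow_mul_and_not_dvd
    refine ⟨_, c', ?_, h2, congrArg Subtype.val h1⟩
    intro h0
    rw [h0, pow_zero, one_mul] at h1
    apply h2
    rw [← h1]
    obtain ⟨G, hG⟩ := adj_dvd (K := K) (F := Polynomial.C c) hD.hm hD.px.ne_zero (by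
      intro i
      rw [Polynomial.coeff_C]
      split_ifs
      · exact hcm
      · exact zero_mem _)
    refine ⟨⟨_, mem_adj.2 ⟨G, rfl⟩⟩, Subtype.ext ?_⟩
    rw [Polynomial.eval₂_C] at hG
    exact hG
  have hle := IsLocalRing.le_maximalIdeal hne
  obtain ⟨p, a1, hp, hna, ea⟩ := hfac a ha0 (hle (Ideal.subset_span (by simp)))
  obtain ⟨q, b1, hq, hnb, eb⟩ := hfac b hb0 (hle (Ideal.subset_span (by simp)))
  rcases le_total p q with hpq | hpq
  · obtain ⟨l, rfl⟩ := Nat.exists_eq_add_of_le hpq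
    exact chart_aux hD ha0 hb0 hab hfin ih hE (le_adj D _) (a' := a1) (b' := X ^ l * b1) hp ea
      (by rw [eb]; push_cast; rw [pow_add]; ring) hna
  · obtain ⟨l, rfl⟩ := Nat.exists_eq_add_of_le hpq
    apply Pp_symm
    rw [inv_div]
    have hsw : (Ideal.span {b, a} : Ideal D) = Ideal.span {a, b} := by rw [Set.pair_comm]
    exact chart_aux hD hb0 ha0 (hab.symm ha0) (by rwa [hsw]) (by rwa [hsw]) hE
      (le_adj D _)      (a' := b1) (b' := X ^ l * a1) hq eb
      (by rw [ea]; push_cast; rw [pow_add]; ring) hnb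

theorem Pp_main (n : ℕ) : ∀ (D : Subring K) (x y : D), Good D x y → ∀ a b : D, a ≠ 0 → b ≠ 0 →
      Rg a b → Order.coheight (Ideal.span {a, b} : Ideal D) < n → Pp D ((b : K) / a) := by
  induction n with
  | zero => intro D x y _ a b _ _ _ h; simp at h
  | succ n ih =>
    intro D x y hD a b ha0 hb0 hab hlt
    have := hD.noeth
    have := hD.loc
    have haK : (a : K) ≠ 0 := fun h => ha0 (Subtype.ext h)
    have hbK : (b : K) ≠ 0 := fun h => hb0 (Subtype.ext h)
    by_cases hne : (Ideal.span {a, b} : Ideal D) = ⊤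
    · have : IsUnit a ∨ IsUnit b := by
        by_contra! hcon
        have h1 : Ideal.span {a, b} ≤ maximalIdeal D := by
          rw [Ideal.span_le]
          rintro z (rfl | rfl)
          · exact (mem_maximalIdeal _).2 hcon.1
          · exact (mem_maximalIdeal _).2 hcon.2
        rw [hne, top_le_iff] at h1
        exact (maximalIdeal.isMaximal D).ne_top h1
      rcases this with hu | hu
      · obtain ⟨w, hw⟩ := hu.exists_right_inv
        have hw' : (a : K) * w = 1 := congrArg Subtype.val hw
        refine Pp_of_mem ?_
        have e : (b : K) / a = b * w := by
          rw [div_eq_iff haK]; linear_combination -(b : K) * hw'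
        rw [e]; exact mul_mem b.2 w.2
      · obtain ⟨w, hw⟩ := hu.exists_right_inv
        have hw' : (b : K) * w = 1 := congrArg Subtype.val hw
        refine Pp_of_inv_mem ?_
        have e : ((b : K) / a)⁻¹ = a * w := by
          rw [inv_div, div_eq_iff hbK]; linear_combination -(a : K) * hw'
        rw [e]; exact mul_mem a.2 w.2
    have hfin : Order.coheight (Ideal.span {a, b} : Ideal D) ≠ ⊤ := ne_top_of_lt hlt
    have hle : Order.coheight (Ideal.span {a, b} : Ideal D) ≤ n := by
      rw [Nat.cast_add, Nat.cast_one] at hlt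
      exact Order.le_of_lt_add_one hlt
    have ih' : ∀ (D' : Subring K) (x' y' : D'), Good D' x' y' → ∀ a' b' : D', a' ≠ 0 → b' ≠ 0 →
      Rg a' b' → Order.coheight (Ideal.span {a', b'} : Ideal D') <
        Order.coheight (Ideal.span {a, b} : Ideal D) → Pp D' ((b' : K) / a') :=
      fun D' x' y' hg a' b' h1 h2 h3 h4 => ih D' x' y' hg a' b' h1 h2 h3 (lt_of_lt_of_le h4 hle)
    refine Pp_glue (t := (y : K) / x) (h12_blow hD.normal hD.hm hD.px hD.nd)
      (chart hD ha0 hb0 hab hfin hne ih') ?_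
    rw [inv_div]
    exact chart hD.symm ha0 hb0 hab hfin hne ih'

end Main

end Stmt19

open IsLocalRing

namespace Stmt19

section Base

variable {R : Type*} [CommRing R] [IsDomain R] [IsNoetherianRing R] [IsLocalRing R]

lemma not_le_rad (hdim : ringKrullDim R = 2) (p : R) (hp : p ∈ maximalIdeal R) :
    ¬ maximalIdeal R ≤ (Ideal.span {p}).radical := by
  intro h
  have h1 : maximalIdeal R ∈ (Ideal.span {p}).minimalPrimes := by
    refine ⟨⟨inferInstance, (Ideal.span_singleton_le_iff_mem _).2 hp⟩, ?_⟩
    rintro q ⟨hq, hpq⟩ _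
    exact h.trans (hq.radical_le_iff.2 hpq)
  have h2 := Ideal.height_le_one_of_isPrincipal_of_mem_minimalPrimes (Ideal.span {p}) _ h1
  have h3 := IsLocalRing.maximalIdeal_height_eq_ringKrullDim (R := R)
  rw [hdim] at h3
  have h4 : (maximalIdeal R).height = 2 :=
    WithBot.coe_inj.1 (h3.trans (rfl : (2 : WithBot ℕ∞) = ((2 : ℕ∞) : WithBot ℕ∞)))
  rw [h4] at h2
  exact absurd h2 (by decide)

lemma base_not_dvd (hdim : ringKrullDim R = 2) {x y : R}
    (hm : maximalIdeal R = Ideal.span {x, y}) (n : ℕ) : ¬ x ∣ y ^ n := by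
  intro h
  have hxm : x ∈ maximalIdeal R := by rw [hm]; exact Ideal.subset_span (by simp)
  apply not_le_rad hdim x hxm
  rw [hm, Ideal.span_le]
  rintro z (rfl | rfl)
  · exact Ideal.le_radical (Ideal.mem_span_singleton_self _)
  · exact ⟨n, Ideal.mem_span_singleton.2 h⟩

lemma base_prime (hdim : ringKrullDim R = 2) {x y : R}
    (hm : maximalIdeal R = Ideal.span {x, y}) : Prime x := by
  refine prime_of_not_dvd_pow ?_ hm (base_not_dvd hdim hm)
  rintro rfl
  have hym : y ∈ maximalIdeal R := by rw [hm]; exact Ideal.subset_span (by simp)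
  apply not_le_rad hdim y hym
  rw [hm, Ideal.span_le]
  rintro z (rfl | rfl)
  · exact zero_mem _
  · exact Ideal.le_radical (Ideal.mem_span_singleton_self _)

lemma base_relprime (hdim : ringKrullDim R = 2) {a b : R}
    (hQ : (Ideal.span {a, b} : Ideal R).radical = maximalIdeal R) : IsRelPrime a b := by
  intro d hda hdb
  by_contra hu
  apply not_le_rad hdim d ((mem_maximalIdeal _).2 hu)
  rw [← hQ]
  apply Ideal.radical_mono
  rw [Ideal.span_le]
  rintro z (rfl | rfl)
  · exact Ideal.mem_span_singleton.2 hda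
  · exact Ideal.mem_span_singleton.2 hdb

lemma base_Rg (hdim : ringKrullDim R = 2) {x y : R}
    (hm : maximalIdeal R = Ideal.span {x, y}) {a b : R}
    (hQ : (Ideal.span {a, b} : Ideal R).radical = maximalIdeal R) : Rg a b := by
  have := ufd_of hm (base_prime hdim hm)
  intro c e h
  exact (base_relprime hdim hQ).dvd_of_dvd_mul_left ⟨e, h⟩

lemma base_ne (hdim : ringKrullDim R = 2) {a b : R}
    (hQ : (Ideal.span {a, b} : Ideal R).radical = maximalIdeal R) : a ≠ 0 := by
  rintro rfl
  have hbm : b ∈ maximalIdeal R := by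
    rw [← hQ]; exact Ideal.le_radical (Ideal.subset_span (by simp))
  have := base_relprime hdim hQ (d := b) (dvd_zero _) dvd_rfl
  exact (mem_maximalIdeal _).1 hbm this

lemma base_fin {Q : Ideal R} (hQ : Q.radical = maximalIdeal R) :
    Order.coheight Q ≠ ⊤ := by
  obtain ⟨k, hk⟩ := Ideal.exists_pow_le_of_le_radical_of_fg hQ.ge (IsNoetherian.noetherian _)
  rw [← Module.length_quotient]
  refine finlen_of_pow k ?_
  intro r hr m
  obtain ⟨m, rfl⟩ := Ideal.Quotient.mk_surjective m
  rw [Algebra.smul_def]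
  change Ideal.Quotient.mk Q r * _ = 0
  rw [Ideal.Quotient.eq_zero_iff_mem.2 (hk hr), zero_mul]

lemma base_normal (hdim : ringKrullDim R = 2) {x y : R}
    (hm : maximalIdeal R = Ideal.span {x, y}) {K : Type*} [Field K] [Algebra R K]
    [IsFractionRing R K] (f : K) (hf : IsIntegral (algebraMap R K).range f) :
    f ∈ (algebraMap R K).range := by
  have := ufd_of hm (base_prime hdim hm)
  have hic : IsIntegrallyClosed R := inferInstance
  have hinj : Function.Injective (algebraMap R K) := IsFractionRing.injective R K
  let e : R ≃+* (algebraMap R K).range := RingEquiv.ofBijective (algebraMap R K).rangeRestrict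
    ⟨fun u v h => hinj (congrArg Subtype.val h), RingHom.rangeRestrict_surjective _⟩
  have h1 : IsIntegral R f := by
    obtain ⟨p, hp, hpe⟩ := hf
    refine ⟨p.map (e.symm : (algebraMap R K).range →+* R), hp.map _, ?_⟩
    rw [Polynomial.eval₂_map]
    have : (algebraMap R K).comp (e.symm : (algebraMap R K).range →+* R)
        = (algebraMap R K).range.subtype := by
      ext z
      obtain ⟨z, rfl⟩ := e.surjective z
      simp only [RingHom.comp_apply, RingHom.coe_coe, RingEquiv.symm_apply_apply]
      rfl
    rw [this]; exact hpe
  obtain ⟨r, hr⟩ := IsIntegrallyClosed.algebraMap_eq_of_integral h1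
  exact ⟨r, hr⟩

theorem base_Pp (hdim : ringKrullDim R = 2) {x y : R}
    (hm : maximalIdeal R = Ideal.span {x, y}) {a b : R}
    (hQ : (Ideal.span {a, b} : Ideal R).radical = maximalIdeal R)
    (K : Type*) [Field K] [Algebra R K] [IsFractionRing R K] :
    Pp (algebraMap R K).range (algebraMap R K b / algebraMap R K a) := by
  have hinj : Function.Injective (algebraMap R K) := IsFractionRing.injective R K
  let D := (algebraMap R K).range
  let e : R ≃+* D := RingEquiv.ofBijective (algebraMap R K).rangeRestrict
    ⟨fun u v h => hinj (congrArg Subtype.val h), RingHom.rangeRestrict_surjective _⟩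
  have hQ' : (Ideal.span {b, a} : Ideal R).radical = maximalIdeal R := by rwa [Set.pair_comm]
  have hm' : maximalIdeal R = Ideal.span {y, x} := by rwa [Set.pair_comm]
  have hnoe : IsNoetherianRing D := isNoetherianRing_of_ringEquiv R e
  have hl : IsLocalRing D := IsLocalRing.of_surjective' e.toRingHom e.surjective
  have hmD : maximalIdeal D = Ideal.span {e x, e y} := by
    have : (maximalIdeal R).map (e : R →+* D) = maximalIdeal D := by
      apply IsLocalRing.eq_maximalIdeal
      exact Ideal.map_isMaximal_of_equiv e
    rw [← this, hm, Ideal.map_span, Set.image_pair]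
    rfl
  have hgood : Good D (e x) (e y) := by
    refine ⟨base_normal hdim hm, hmD, ?_, ?_, ?_⟩
    · exact (MulEquiv.prime_iff e.toMulEquiv).2 (base_prime hdim hm)
    · exact (MulEquiv.prime_iff e.toMulEquiv).2 (base_prime hdim hm')
    · intro h
      have h2 : x ∣ y := by simpa using map_dvd e.symm h
      exact base_not_dvd hdim hm 1 (by simpa using h2)
  have hrg : Rg (e a) (e b) := by
    intro c f h
    obtain ⟨c, rfl⟩ := e.surjective c
    obtain ⟨f, rfl⟩ := e.surjective f
    rw [← map_mul, ← map_mul] at h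
    exact map_dvd e (base_Rg hdim hm hQ c f (e.injective h))
  have hfin : Order.coheight (Ideal.span {e a, e b} : Ideal D) ≠ ⊤ := by
    let f : Ideal D → Ideal R := fun J => J.comap e
    have hf : StrictMono f := by
      refine Monotone.strictMono_of_injective (fun J J' hJ => Ideal.comap_mono hJ) ?_
      exact Ideal.comap_injective_of_surjective e e.surjective
    refine ne_top_of_le_ne_top (base_fin hQ)
      ((Order.coheight_le_coheight_apply_of_strictMono f hf _).trans (Order.coheight_anti ?_))
    rw [Ideal.span_le]
    rintro z (rfl | rfl)
    · exact Ideal.subset_span (by simp)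
    · exact Ideal.subset_span (by simp)
  obtain ⟨n, hn⟩ := ENat.ne_top_iff_exists.1 hfin
  have ha0 : e a ≠ 0 := by simpa using base_ne hdim hQ
  have hb0 : e b ≠ 0 := by simpa using base_ne hdim hQ'
  exact Pp_main (n + 1) D (e x) (e y) hgood (e a) (e b) ha0 hb0 hrg (by
    rw [← hn]; exact_mod_cast Nat.lt_succ_self n)

end Base

end Stmt19

open IsLocalRing

namespace Stmt19

/-- Integrality equation of `z` over the ideal `I`. -/
def IntEq {R : Type*} [CommRing R] (I : Ideal R) (z : R) : Prop :=
  ∃ n : ℕ, 0 < n ∧ ∃ c : ℕ → R, (∀ i, 1 ≤ i → i ≤ n → c i ∈ I ^ i) ∧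
    z ^ n + ∑ i ∈ Finset.Icc 1 n, c i * z ^ (n - i) = 0

section F1

variable {R : Type*} [CommRing R] [IsDomain R] {K : Type*} [Field K] [Algebra R K]

lemma inteq_of_val (hinj : Function.Injective (algebraMap R K)) {a b r : R}
    (h1 : ∀ V : ValuationSubring K, (algebraMap R K).range ≤ V.toSubring →
      algebraMap R K b / algebraMap R K a ∈ V → algebraMap R K r / algebraMap R K a ∈ V)
    (h2 : ∀ V : ValuationSubring K, (algebraMap R K).range ≤ V.toSubring →
      (algebraMap R K b / algebraMap R K a)⁻¹ ∈ V → algebraMap R K r / algebraMap R K b ∈ V)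
    (hb0 : b ≠ 0) (ha0 : a ≠ 0) : IntEq (Ideal.span {a, b}) r := by
  by_cases hr : r = 0
  · refine ⟨1, one_pos, fun _ => 0, fun i _ _ => Ideal.zero_mem _, by simp [hr]⟩
  set Q : Ideal R := Ideal.span {a, b} with hQ
  set g := algebraMap R K r with hg
  have hg0 : g ≠ 0 := by rw [hg]; exact fun h => hr (hinj (by simpa using h))
  have hα0 : algebraMap R K a ≠ 0 := fun h => ha0 (hinj (by simpa using h))
  have hβ0 : algebraMap R K b ≠ 0 := fun h => hb0 (hinj (by simpa using h))
  let ψ : reesAlgebra Q →+* K :=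
    ((Polynomial.aeval g⁻¹ : Polynomial R →ₐ[R] K).comp (reesAlgebra Q).val : _ →+* K)
  have hψ : ∀ f : reesAlgebra Q, ψ f = Polynomial.aeval g⁻¹ (f : Polynomial R) := fun f => rfl
  let κ : reesAlgebra Q →+* R :=
    (Polynomial.constantCoeff : Polynomial R →+* R).comp ((reesAlgebra Q).val : _ →+* Polynomial R)
  have hκ : ∀ f : reesAlgebra Q, κ f = (f : Polynomial R).coeff 0 := fun f => rfl
  have hmono : ∀ s ∈ Q, ∀ V : ValuationSubring K,
      (ψ.range.subtype '' (Ideal.map ψ.rangeRestrict (RingHom.ker κ)) ⊆ V.nonunits) →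
      algebraMap R K s / g ∈ V.nonunits := by
    intro s hs V hV
    let f : reesAlgebra Q := ⟨Polynomial.monomial 1 s, reesAlgebra.monomial_mem.2 (by simpa using hs)⟩
    have hf : f ∈ RingHom.ker κ := by
      rw [RingHom.mem_ker, hκ]; simp [f]
    have := hV ⟨_, Ideal.mem_map_of_mem ψ.rangeRestrict hf, rfl⟩
    have e : ψ.range.subtype (ψ.rangeRestrict f) = algebraMap R K s / g := by
      change ψ f = _
      rw [hψ]; simp [f, Polynomial.aeval_monomial, div_eq_mul_inv]
    rwa [e] at this
  by_cases htop : Ideal.map ψ.rangeRestrict (RingHom.ker κ) = ⊤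
  · have h1 : (1 : ψ.range) ∈ Ideal.map ψ.rangeRestrict (RingHom.ker κ) := by rw [htop]; trivial
    obtain ⟨f, hf, hf1⟩ :=
      (Ideal.mem_map_iff_of_surjective _ ψ.rangeRestrict_surjective).1 h1
    rw [RingHom.mem_ker, hκ] at hf
    have hf1 : ψ f = 1 := congrArg Subtype.val hf1
    rw [hψ] at hf1
    obtain ⟨F, hF⟩ := f
    simp only at hf hf1
    set n := F.natDegree with hn
    have hn0 : 0 < n := by
      by_contra h0
      have : F = 0 := by
        rw [Polynomial.eq_C_of_natDegree_eq_zero (p := F) (by omega), hf, Polynomial.C_0]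
      rw [this] at hf1; simp at hf1
    refine ⟨n, hn0, fun i => - F.coeff i, fun i _ _ => (Ideal.neg_mem_iff _).2 (hF i), ?_⟩
    apply hinj
    have key : g ^ n * Polynomial.aeval g⁻¹ F = ∑ i ∈ Finset.Icc 1 n, algebraMap R K (F.coeff i) * g ^ (n - i) := by
      rw [Polynomial.aeval_eq_sum_range, Finset.mul_sum, Finset.range_eq_Ico,
        Finset.sum_eq_sum_Ico_succ_bot (by omega), hf]
      simp only [zero_smul, mul_zero, zero_add]
      refine Finset.sum_congr rfl ?_
      intro i hi
      have hi := Finset.mem_Icc.1 hi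
      rw [Algebra.smul_def, pow_sub₀ _ hg0 (by omega), inv_pow]; ring
    rw [hf1, mul_one] at key
    simp only [map_add, map_sum, map_mul, map_pow, map_neg, map_zero, ← hg, neg_mul,
      Finset.sum_neg_distrib, key, add_neg_cancel]
  · exfalso
    obtain ⟨V, hV1, hV2⟩ := Ideal.image_subset_nonunits_valuationSubring _ htop
    have hDV : (algebraMap R K).range ≤ V.toSubring := by
      rintro _ ⟨s, rfl⟩
      apply hV1
      refine ⟨algebraMap R _ s, ?_⟩
      rw [hψ]; simp
    rcases V.mem_or_inv_mem (algebraMap R K b / algebraMap R K a) with h | h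
    · have := hmono a (Ideal.subset_span (by simp)) V hV2
      rw [← inv_div, V.inv_mem_nonunits_iff] at this
      rcases this with h' | h'
      · exact (div_ne_zero hg0 hα0) h'
      · exact h' (h1 V hDV h)
    · have := hmono b (Ideal.subset_span (by simp)) V hV2
      rw [← inv_div, V.inv_mem_nonunits_iff] at this
      rcases this with h' | h'
      · exact (div_ne_zero hg0 hβ0) h'
      · exact h' (h2 V hDV h)

end F1

end Stmt19

open IsLocalRing

namespace Stmt19

section FnSec

variable {K : Type*} [Field K]

/-- Global sections of the `n`th twist. -/
def Fn (D : Subring K) (α β : K) (n : ℕ) (g : K) : Prop :=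
  (∀ V : ValuationSubring K, D ≤ V.toSubring → β / α ∈ V → g / α ^ n ∈ V) ∧
  (∀ V : ValuationSubring K, D ≤ V.toSubring → (β / α)⁻¹ ∈ V → g / β ^ n ∈ V)

lemma key2 {D : Subring K} {α β : K} (hα : α ≠ 0) (hβ : β ≠ 0) (hP : Pp D (β / α)) {X : Set K}
    (hX : ∀ g, Fn D α β 1 g → g ∈ X) (n : ℕ) : ∀ f, Fn D α β (n + 1) f →
      f / α ^ n ∈ Submodule.span (adj D (β / α)) X := by
  induction n with
  | zero => intro f hf; simpa using Submodule.subset_span (hX f hf)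
  | succ n ih =>
    intro f hf
    obtain ⟨G, hG1, hG2⟩ := hP (f / (α ^ (n + 1) * β)) (by
      intro V hD h1 h2
      have := V.mul_mem _ _ (hf.1 V hD h1) h2
      have e : f / (α ^ (n + 1) * β) = f / α ^ (n + 1 + 1) * (β / α)⁻¹ := by
        simp only [pow_succ, inv_div]; field_simp
      rwa [e])
    have h1 : Fn D α β (n + 1) (α ^ (n + 1) * G) := by
      constructor
      · intro V hD h
        have e : α ^ (n + 1) * G / α ^ (n + 1) = G := by field_simp
        rw [e]; exact hG1 V hD h
      · intro V hD h
        have e : α ^ (n + 1) * G / β ^ (n + 1) = f / β ^ (n + 1 + 1) -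
            ((β / α)⁻¹) ^ (n + 1) * (f / (α ^ (n + 1) * β) - G) := by
          simp only [pow_succ, inv_div, div_pow]; field_simp; ring
        rw [e]
        exact sub_mem (hf.2 V hD h) (mul_mem (pow_mem h _) (hG2 V hD h))
    have h2 : Fn D α β 1 (f / α ^ (n + 1) - β * G) := by
      constructor
      · intro V hD h
        have e : (f / α ^ (n + 1) - β * G) / α ^ 1 = f / α ^ (n + 1 + 1) - β / α * G := by
          simp only [pow_succ]; field_simp; try ring
        rw [e]
        exact sub_mem (hf.1 V hD h) (mul_mem h (hG1 V hD h))
      · intro V hD h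
        have e : (f / α ^ (n + 1) - β * G) / β ^ 1 = f / (α ^ (n + 1) * β) - G := by
          field_simp
        rw [e]
        exact hG2 V hD h
    have h3 := Submodule.smul_mem _ (⟨β / α, self_mem_adj D _⟩ : adj D (β / α)) (ih _ h1)
    have h4 := Submodule.add_mem _ h3 (Submodule.subset_span (hX _ h2))
    convert h4 using 1
    rw [Subring.smul_def, smul_eq_mul]
    field_simp
    ring

lemma S_IA {D : Subring K} {α β : K} (hα : α ≠ 0) (hβ : β ≠ 0) (hP : Pp D (β / α)) {X : Set K}
    (hX : ∀ g, Fn D α β 1 g → g ∈ X) {z : K} (hz : IsIntegral (adj D (β / α)) z) :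
    α * z ∈ Submodule.span (adj D (β / α)) X := by
  obtain ⟨s, ⟨N, rfl⟩, hs⟩ := integral_scale (E := adj D (β / α)⁻¹)
    (Submonoid.powers (β / α)⁻¹)
    (by rintro _ ⟨k, rfl⟩; exact pow_mem (self_mem_adj D _) k)
    (by
      intro e he
      obtain ⟨F, rfl⟩ := mem_adj.1 he
      refine ⟨_, ⟨F.natDegree, rfl⟩, ?_⟩
      rw [Polynomial.eval₂_eq_sum_range, Finset.mul_sum]
      refine Subring.sum_mem _ fun i hi => ?_
      have hi' : i ≤ F.natDegree := by simpa [Nat.lt_succ_iff] using hi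
      have hT : β / α ≠ 0 := div_ne_zero hβ hα
      have e : (β / α)⁻¹ ^ F.natDegree * (D.subtype (F.coeff i) * (β / α) ^ i) =
          (F.coeff i : K) * (β / α)⁻¹ ^ (F.natDegree - i) := by
        rw [pow_sub₀ _ (inv_ne_zero hT) hi', inv_pow _ i, inv_inv]
        simp only [Subring.subtype_apply]; ring
      show (β / α)⁻¹ ^ F.natDegree * _ ∈ _
      rw [e]
      exact mul_mem (le_adj D _ (F.coeff i).2) (pow_mem (self_mem_adj D _) _)) hz
  have h := key2 hα hβ hP hX N (α ^ (N + 1) * z) (by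
    constructor
    · intro V hD h
      have e : α ^ (N + 1) * z / α ^ (N + 1) = z := by field_simp
      rw [e]
      exact (cl_adj_iff D _ z).1 hz V hD h
    · intro V hD h
      have e : α ^ (N + 1) * z / β ^ (N + 1) = (β / α)⁻¹ * ((β / α)⁻¹ ^ N * z) := by
        simp only [pow_succ, inv_div, div_pow]; field_simp
      rw [e]
      exact mul_mem h ((cl_adj_iff D _ _).1 hs V hD h))
  have e : α ^ (N + 1) * z / α ^ N = α * z := by field_simp; ring
  rwa [e] at h

end FnSec

end Stmt19

open IsLocalRing

namespace Stmt19

section LocVal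

variable {K : Type*} [Field K]

lemma loc_val {S : Subring K} [IsNoetherianRing S] (hn : ∀ f : K, IsIntegral S f → f ∈ S)
    (hfr : ∀ f : K, ∃ s t : S, f = s / t) (α : S) (p : Ideal S) [p.IsPrime]
    (hp : p ∈ (Ideal.span {α}).minimalPrimes) :
    ∃ V : ValuationSubring K, S ≤ V.toSubring ∧ ∀ v ∈ V, ∃ s : S, s ∉ p ∧ (s : K) * v ∈ S := by
  set L := (LocalSubring.ofPrime S p).toSubring with hL
  have : IsLocalRing L := (LocalSubring.ofPrime S p).isLocalRing
  have hloc : IsLocalization.AtPrime L p := inferInstance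
  have hnoe : IsNoetherianRing L := IsLocalization.isNoetherianRing p.primeCompl L inferInstance
  have hSL : S ≤ L := fun s hs => mem_ofPrime.2 ⟨1, p.one_notMem, by simpa using hs⟩
  have hfrac : IsFractionRing L K := by
    refine IsFractionRing.of_field L K fun z => ?_
    obtain ⟨s, t, e⟩ := hfr z
    exact ⟨⟨s, hSL s.2⟩, ⟨t, hSL t.2⟩, e⟩
  have hnL : ∀ f : K, IsIntegral L f → f ∈ L := by
    intro f hf
    obtain ⟨s, ⟨w, hw, e⟩, h1⟩ := integral_scale (E := S) (p.primeCompl.map S.subtype)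
      (by rintro _ ⟨w, _, rfl⟩; exact w.2) (fun e he => by
        obtain ⟨s, hs, h2⟩ := mem_ofPrime.1 he
        exact ⟨s, ⟨s, hs, rfl⟩, h2⟩) hf
    refine mem_ofPrime.2 ⟨w, hw, ?_⟩
    rw [← e] at h1
    exact hn _ h1
  have hic : IsIntegrallyClosed L := by
    rw [isIntegrallyClosed_iff K]
    intro f hf
    exact ⟨⟨f, hnL f hf⟩, rfl⟩
  have hht : p.height ≤ 1 := Ideal.height_le_one_of_isPrincipal_of_mem_minimalPrimes _ p hp
  have hval : ValuationRing L := by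
    have htf : ValuationRing L ↔
        IsIntegrallyClosed L ∧ ∀ P : Ideal L, P ≠ ⊥ → P.IsPrime → P = maximalIdeal L :=
      (tfae_of_isNoetherianRing_of_isLocalRing_of_isDomain L).out 1 3
    refine htf.2 ⟨hic, ?_⟩
    intro q hq0 hq
    have hle : q.comap (algebraMap S L) ≤ p := by
      have h1 : q ≤ maximalIdeal L := le_maximalIdeal hq.ne_top
      have h2 := Ideal.comap_mono (f := algebraMap S L) h1
      exact h2.trans (IsLocalization.AtPrime.under_maximalIdeal L p).le
    have hqp : (q.comap (algebraMap S L)).IsPrime := inferInstance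
    have heq : q.comap (algebraMap S L) = p := by
      by_contra hne
      have hlt := Ideal.height_le_iff.1 hht _ hqp (lt_of_le_of_ne hle hne)
      have h0 : (q.comap (algebraMap S L)).height = 0 := by
        exact_mod_cast Order.lt_one_iff.1 hlt
      rw [Ideal.height_eq_zero_iff, IsDomain.minimalPrimes_eq_singleton_bot] at h0
      have h1 := IsLocalization.map_under p.primeCompl L q
      rw [Set.mem_singleton_iff] at h0
      change Ideal.map _ (Ideal.comap (algebraMap S L) q) = q at h1
      rw [h0, Ideal.map_bot] at h1
      exact hq0 h1.symm
    have h1 := IsLocalization.map_under p.primeCompl L q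
    change Ideal.map _ (Ideal.comap (algebraMap S L) q) = q at h1
    rw [← h1, heq, IsLocalization.AtPrime.map_eq_maximalIdeal p L]
  refine ⟨{ L with mem_or_inv_mem' := ?_ }, hSL, fun v hv => mem_ofPrime.1 hv⟩
  intro f
  rcases ValuationRing.isInteger_or_isInteger L f with ⟨g, e⟩ | ⟨g, e⟩
  · left; rw [← e]; exact g.2
  · right; rw [← e]; exact g.2

lemma val_int {R : Type*} [CommRing R] [IsNoetherianRing R] [Algebra R K] (V : ValuationSubring K)
    (hV : (algebraMap R K).range ≤ V.toSubring) (J : Ideal R) (hJ : ∃ j ∈ J, algebraMap R K j ≠ 0)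
    {z : R} (hz : IntEq J z) :
    ∃ j ∈ J, algebraMap R K j ≠ 0 ∧ algebraMap R K z / algebraMap R K j ∈ V := by
  -- generator of largest value
  have hmax : ∃ j ∈ J, algebraMap R K j ≠ 0 ∧ ∀ i ∈ J, algebraMap R K i / algebraMap R K j ∈ V := by
    obtain ⟨s, hs⟩ := (isNoetherianRing_iff_ideal_fg R).1 inferInstance J
    have hne : s.Nonempty := by
      rw [Finset.nonempty_iff_ne_empty]
      rintro rfl
      obtain ⟨j, hj, h0⟩ := hJ
      rw [← hs] at hj
      simp at hj
      exact h0 (by simp [hj])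
    obtain ⟨j, hjs, hj⟩ := s.exists_max_image (fun j => V.valuation (algebraMap R K j)) hne
    have hle : ∀ i ∈ J, V.valuation (algebraMap R K i) ≤ V.valuation (algebraMap R K j) := by
      intro i hi
      rw [← hs] at hi
      induction hi using Submodule.span_induction with
      | mem i hi => exact hj i hi
      | zero => simp
      | add u v _ _ hu hv =>
        rw [map_add]; exact (V.valuation.map_add _ _).trans (max_le hu hv)
      | smul r u _ hu =>
        rw [smul_eq_mul, map_mul, map_mul]
        have : V.valuation (algebraMap R K r) ≤ 1 := (V.valuation_le_one_iff _).2 (hV ⟨r, rfl⟩)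
        exact (mul_le_of_le_one_left' this).trans hu
    have hj0 : algebraMap R K j ≠ 0 := by
      intro h0
      obtain ⟨i, hi, hi0⟩ := hJ
      have := hle i hi
      rw [h0, map_zero, le_zero_iff, map_eq_zero] at this
      exact hi0 this
    refine ⟨j, by rw [← hs]; exact Submodule.subset_span hjs, hj0, fun i hi => ?_⟩
    rw [← V.valuation_le_one_iff, map_div₀]
    exact div_le_one_of_le₀ (hle i hi) zero_le
  obtain ⟨j, hjJ, hj0, hj⟩ := hmax
  refine ⟨j, hjJ, hj0, ?_⟩
  have hpow : ∀ n : ℕ, ∀ i ∈ J ^ n, algebraMap R K i / algebraMap R K j ^ n ∈ V := by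
    intro n
    induction n with
    | zero => intro i _; simpa using hV ⟨i, rfl⟩
    | succ n ih =>
      intro i hi
      rw [pow_succ] at hi
      induction hi using Submodule.mul_induction_on' with
      | mem_mul_mem u hu v hv =>
        have e : algebraMap R K (u * v) / algebraMap R K j ^ (n + 1) =
          (algebraMap R K u / algebraMap R K j ^ n) * (algebraMap R K v / algebraMap R K j) := by
          rw [map_mul, pow_succ, mul_div_mul_comm]
        rw [e]
        exact mul_mem (ih u hu) (hj v hv)
      | add u _ v _ hu hv =>
        rw [map_add, add_div]; exact add_mem hu hv
  obtain ⟨n, hn, c, hc, h⟩ := hz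
  set g := algebraMap R K z / algebraMap R K j with hg
  rcases V.mem_or_inv_mem g with h' | h'
  · exact h'
  by_cases hg0 : g = 0
  · rw [hg0]; exact V.zero_mem
  have hz0 : algebraMap R K z = g * algebraMap R K j := by rw [hg]; field_simp
  have h2 := congrArg (algebraMap R K) h
  simp only [map_add, map_sum, map_mul, map_pow, map_zero, hz0] at h2
  obtain ⟨n, rfl⟩ := Nat.exists_eq_succ_of_ne_zero hn.ne'
  have e : g = - ∑ i ∈ Finset.Icc 1 (n + 1),
      (algebraMap R K (c i) / algebraMap R K j ^ i) * g⁻¹ ^ (i - 1) := by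
    have h3 : (g ^ n * algebraMap R K j ^ (n + 1)) * g = (g ^ n * algebraMap R K j ^ (n + 1)) *
      (- ∑ i ∈ Finset.Icc 1 (n + 1), (algebraMap R K (c i) / algebraMap R K j ^ i) * g⁻¹ ^ (i - 1)) := by
      rw [mul_neg, Finset.mul_sum, eq_neg_iff_add_eq_zero, ← h2, Nat.succ_eq_add_one]
      congr 1
      · ring
      refine Finset.sum_congr rfl fun i hi => ?_
      obtain ⟨h1, h4⟩ := Finset.mem_Icc.1 hi
      obtain ⟨i, rfl⟩ := Nat.exists_eq_add_of_le' h1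
      obtain ⟨k, rfl⟩ := Nat.exists_eq_add_of_le' (show i ≤ n by omega)
      have e1 : k + i + 1 - (i + 1) = k := by omega
      rw [e1, Nat.add_sub_cancel, inv_pow]
      field_simp
      ring
    exact mul_left_cancel₀ (by positivity) h3
  rw [e]
  refine neg_mem (sum_mem fun i hi => mul_mem (hpow i _ (hc i ?_ ?_)) (pow_mem h' _))
  · exact (Finset.mem_Icc.1 hi).1
  · exact (Finset.mem_Icc.1 hi).2

end LocVal

end Stmt19

open IsLocalRing

namespace Stmt19

section Final

variable {R : Type*} [CommRing R] [IsDomain R] [IsNoetherianRing R] [IsLocalRing R]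

lemma mem_adj_range {K : Type*} [Field K] [Algebra R K] {T z : K} :
    z ∈ adj (algebraMap R K).range T ↔ ∃ F : Polynomial R, Polynomial.aeval T F = z := by
  rw [mem_adj]
  constructor
  · rintro ⟨F, rfl⟩
    obtain ⟨F, rfl⟩ := Polynomial.map_surjective _ (algebraMap R K).rangeRestrict_surjective F
    refine ⟨F, ?_⟩
    rw [Polynomial.eval₂_map, Polynomial.aeval_def]
    rfl
  · rintro ⟨F, rfl⟩
    refine ⟨F.map (algebraMap R K).rangeRestrict, ?_⟩
    rw [Polynomial.eval₂_map, Polynomial.aeval_def]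
    rfl

theorem final (K : Type*) [Field K] [Algebra R K] [IsFractionRing R K] (hdim : ringKrullDim R = 2) {x y : R}
    (hm : maximalIdeal R = Ideal.span {x, y}) {I : Ideal R}
    (hIc : ∀ z, IntEq I z → z ∈ I) {a b : R} (hQI : Ideal.span {a, b} ≤ I)
    (hQ : (Ideal.span {a, b} : Ideal R).radical = maximalIdeal R)
    (hred : I ^ 2 = Ideal.span {a, b} * I) {J : Ideal R}
    (hJ : ∀ j, j ∈ J ↔ ∀ i ∈ I, j * i ∈ Ideal.span {a, b}) {z : R} (hz : IntEq J z) :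
    z ∈ J := by
  have hinj : Function.Injective (algebraMap R K) := IsFractionRing.injective R K
  have hQ' : (Ideal.span {b, a} : Ideal R).radical = maximalIdeal R := by rwa [Set.pair_comm]
  have ha0 : a ≠ 0 := base_ne hdim hQ
  have hb0 : b ≠ 0 := base_ne hdim hQ'
  set D := (algebraMap R K).range with hD
  set α := algebraMap R K a with hα
  set β := algebraMap R K b with hβ
  have hα0 : α ≠ 0 := fun h => ha0 (hinj (by rw [map_zero]; exact h))
  have hβ0 : β ≠ 0 := fun h => hb0 (hinj (by rw [map_zero]; exact h))
  set T := β / α with hT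
  have hP : Pp D T := base_Pp hdim hm hQ K
  set A := adj D T with hA
  have hDA : ∀ r : R, algebraMap R K r ∈ A := fun r => le_adj D T ⟨r, rfl⟩
  have hTA : T ∈ A := self_mem_adj D T
  -- elements of I
  have hX : ∀ g, Fn D α β 1 g → g ∈ algebraMap R K '' I := by
    intro g hg
    have hgD : g ∈ D := by
      apply base_normal hdim hm
      rw [cl_iff]
      intro V hV
      rcases V.mem_or_inv_mem T with h | h
      · have h1 := mul_mem (hg.1 V hV h) (hV ⟨a, rfl⟩ : α ∈ V)
        rwa [pow_one, div_mul_cancel₀ _ hα0] at h1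
      · have h1 := mul_mem (hg.2 V hV h) (hV ⟨b, rfl⟩ : β ∈ V)
        rwa [pow_one, div_mul_cancel₀ _ hβ0] at h1
    obtain ⟨r, rfl⟩ := hgD
    refine ⟨r, hIc r ?_, rfl⟩
    have h := inteq_of_val hinj (a := a) (b := b) (r := r)
      (fun V h1 h2 => by simpa using hg.1 V h1 h2)
      (fun V h1 h2 => by simpa using hg.2 V h1 h2) hb0 ha0
    obtain ⟨n, hn, c, hc, e⟩ := h
    exact ⟨n, hn, c, fun i h1 h2 => Ideal.pow_right_mono hQI i (hc i h1 h2), e⟩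
  set IA : Submodule A K := Submodule.span A (algebraMap R K '' I) with hIA
  have hS : ∀ f, IsIntegral A f → α * f ∈ IA := fun f hf => S_IA hα0 hβ0 hP hX hf
  have hIAA : ∀ k ∈ IA, k ∈ A := by
    intro k hk
    induction hk using Submodule.span_induction with
    | mem k hk => obtain ⟨i, _, rfl⟩ := hk; exact hDA i
    | zero => exact zero_mem _
    | add u v _ _ hu hv => exact add_mem hu hv
    | smul r u _ hu => rw [Subring.smul_def]; exact mul_mem r.2 hu
  have hQA : ∀ q ∈ (Ideal.span {a, b} : Ideal R), algebraMap R K q / α ∈ A := by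
    intro q hq
    obtain ⟨r, s, rfl⟩ := Ideal.mem_span_pair.1 hq
    have e : algebraMap R K (r * a + s * b) / α = algebraMap R K r + algebraMap R K s * T := by
      rw [map_add, map_mul, map_mul, ← hα, ← hβ, hT]; field_simp
    rw [e]
    exact add_mem (hDA r) (mul_mem (hDA s) hTA)
  have hJIA : ∀ j ∈ J, ∀ k ∈ IA, algebraMap R K j * k / α ∈ A := by
    intro j hj k hk
    induction hk using Submodule.span_induction with
    | mem k hk =>
      obtain ⟨i, hi, rfl⟩ := hk
      rw [← map_mul]
      exact hQA _ ((hJ j).1 hj i hi)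
    | zero => simp
    | add u v _ _ hu hv => rw [mul_add, add_div]; exact add_mem hu hv
    | smul r u _ hu =>
      have e : algebraMap R K j * (r • u) / α = r * (algebraMap R K j * u / α) := by
        rw [Subring.smul_def, smul_eq_mul]; ring
      rw [e]; exact mul_mem r.2 hu
  have hJS : ∀ j ∈ J, ∀ f, IsIntegral A f → algebraMap R K j * f ∈ A := by
    intro j hj f hf
    have := hJIA j hj _ (hS f hf)
    have e : algebraMap R K j * (α * f) / α = algebraMap R K j * f := by field_simp
    rwa [e] at this
  -- noetherianity
  have hnD : IsNoetherianRing D := by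
    let e : R ≃+* D := RingEquiv.ofBijective (algebraMap R K).rangeRestrict
      ⟨fun u v h => hinj (congrArg Subtype.val h), RingHom.rangeRestrict_surjective _⟩
    exact isNoetherianRing_of_ringEquiv R e
  have hnA : IsNoetherianRing A := adj_noeth T
  have hIAfg : IA.FG := by
    refine Submodule.FG.of_le (T := Submodule.span A {(1 : K)}) (Submodule.fg_span_singleton _) ?_
    intro k hk
    rw [Submodule.mem_span_singleton]
    exact ⟨⟨k, hIAA k hk⟩, by rw [Subring.smul_def]; simp⟩
  have hIw : ∀ w ∈ I, IsIntegral A (algebraMap R K w / α) := by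
    intro w hw
    refine isIntegral_of_smul_mem_submodule IA ?_ hIAfg _ ?_
    · intro h
      have h1 : α ∈ IA := Submodule.subset_span ⟨a, hQI (Ideal.subset_span (by simp)), rfl⟩
      rw [h, Submodule.mem_bot] at h1
      exact hα0 h1
    · intro k hk
      have hq : ∀ t ∈ (Ideal.span {a, b} : Ideal R) * I, algebraMap R K t / α ∈ IA := by
        intro t ht
        induction ht using Submodule.mul_induction_on' with
        | mem_mul_mem q hq i hi =>
          have h1 := IA.smul_mem (⟨_, hQA q hq⟩ : A) (Submodule.subset_span ⟨i, hi, rfl⟩)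
          convert h1 using 1
          rw [Subring.smul_def, map_mul, smul_eq_mul]; ring
        | add u _ v _ hu hv => rw [map_add, add_div]; exact add_mem hu hv
      induction hk using Submodule.span_induction with
      | mem k hk =>
        obtain ⟨i, hi, rfl⟩ := hk
        have h1 := hq (w * i) (by rw [← hred, pow_two]; exact Ideal.mul_mem_mul hw hi)
        convert h1 using 1
        rw [map_mul, smul_eq_mul]; ring
      | zero => rw [smul_zero]; exact zero_mem _
      | add u v _ _ hu hv => rw [smul_add]; exact add_mem hu hv
      | smul r u _ hu => rw [smul_comm]; exact IA.smul_mem r hu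
  let S := integralClosure A K
  let S' : Subring K := S.toSubring
  have hnS : IsNoetherianRing S := by
    let φ : S →ₗ[A] A :=
      { toFun := fun s => ⟨α * s, hIAA _ (hS s s.2)⟩
        map_add' := fun u v => Subtype.ext (mul_add _ _ _)
        map_smul' := fun r u => Subtype.ext (by
          change α * ((r : K) * (u : K)) = r * (α * u); ring) }
    have hφ : Function.Injective φ := by
      intro u v h
      have h1 : α * (u : K) = α * v := congrArg Subtype.val h
      exact Subtype.ext (mul_left_cancel₀ hα0 h1)
    have : IsNoetherian A S := isNoetherian_of_injective φ hφ
    exact isNoetherian_of_tower A this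
  have hnS' : IsNoetherianRing S' := hnS
  have hSn : ∀ f : K, IsIntegral S' f → f ∈ S' := by
    intro f hf
    have hf' : IsIntegral S f := hf
    exact isIntegral_trans (R := A) f hf'
  have hAS : ∀ f ∈ A, f ∈ S := fun f hf => isIntegral_algebraMap (R := A) (x := ⟨f, hf⟩)
  have hfr : ∀ f : K, ∃ s t : S', f = s / t := by
    intro f
    obtain ⟨s, t, _, e⟩ := IsFractionRing.div_surjective (A := R) f
    exact ⟨⟨_, hAS _ (hDA s)⟩, ⟨_, hAS _ (hDA t)⟩, e.symm⟩
  -- the prime P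
  have hQm : (Ideal.span {a, b} : Ideal R) ≤ maximalIdeal R := by rw [← hQ]; exact Ideal.le_radical
  have hcoef : ∀ F : Polynomial R, Polynomial.aeval T F = 0 →
      ∀ i, F.coeff i ∈ (Ideal.span {a, b} : Ideal R) := fun F hF i =>
    coeff_mem_of_aeval_eq_zero ha0 (base_Rg hdim hm hQ) F.natDegree F le_rfl hF i
  let φ : Polynomial R →+* A :=
    (Polynomial.aeval T : Polynomial R →ₐ[R] K).toRingHom.codRestrict A
      (fun F => mem_adj_range.2 ⟨F, rfl⟩)
  have hφv : ∀ F, (φ F : K) = Polynomial.aeval T F := fun F => rfl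
  have hφs : Function.Surjective φ := by
    rintro ⟨f, hf⟩
    obtain ⟨F, e⟩ := mem_adj_range.1 hf
    exact ⟨F, Subtype.ext e⟩
  let 𝔪X : Ideal (Polynomial R) := (maximalIdeal R).map Polynomial.C
  have h𝔪p : 𝔪X.IsPrime := Ideal.isPrime_map_C_of_isPrime
  have hker : RingHom.ker φ ≤ 𝔪X := by
    intro F hF
    rw [Ideal.mem_map_C_iff]
    exact fun n => hQm (hcoef F (congrArg Subtype.val hF) n)
  let P : Ideal A := 𝔪X.map φ
  have hPp : P.IsPrime := Ideal.map_isPrime_of_surjective hφs hker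
  have hPm : ∀ F, φ F ∉ P → ∃ i, IsUnit (F.coeff i) := by
    intro F hF
    by_contra hcon
    push Not at hcon
    exact hF (Ideal.mem_map_of_mem φ (Ideal.mem_map_C_iff.2 fun n => (mem_maximalIdeal _).2 (hcon n)))
  -- the transporter
  let 𝔱 : Ideal S :=
    { carrier := {d | ∀ s : S, (d : K) * algebraMap R K z * s ∈ A}
      zero_mem' := fun s => by simp
      add_mem' := fun {u v} hu hv s => by
        have := add_mem (hu s) (hv s)
        convert this using 1
        push_cast; ring
      smul_mem' := fun c u hu s => by
        have := hu (c * s)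
        convert this using 1
        rw [smul_eq_mul]; push_cast; ring }
  have hmem𝔱 : ∀ d : S, d ∈ 𝔱 ↔ ∀ s : S, (d : K) * algebraMap R K z * s ∈ A := fun d => Iff.rfl
  have hnot : ¬ 𝔱.comap (algebraMap A S) ≤ P := by
    intro hle
    obtain ⟨𝔭, h𝔱𝔭, h𝔭, h𝔭P⟩ := Ideal.exists_ideal_over_prime_of_isIntegral P 𝔱 hle
    let αA : A := ⟨α, hDA a⟩
    have hαφ : ∀ r ∈ maximalIdeal R, (⟨_, hDA r⟩ : A) ∈ P := by
      intro r hr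
      have e : (⟨_, hDA r⟩ : A) = φ (Polynomial.C r) := by
        apply Subtype.ext; rw [hφv]; simp
      rw [e]
      exact Ideal.mem_map_of_mem φ (Ideal.mem_map_of_mem _ hr)
    let αS : S := algebraMap A S αA
    have hmin : 𝔭 ∈ (Ideal.span {αS}).minimalPrimes := by
      refine ⟨⟨h𝔭, ?_⟩, ?_⟩
      · rw [Ideal.span_singleton_le_iff_mem]
        have h1 : αA ∈ 𝔭.comap (algebraMap A S) := by
          rw [h𝔭P]; exact hαφ a (hQm (Ideal.subset_span (by simp)))
        exact h1
      · rintro 𝔮 ⟨h𝔮, hα𝔮⟩ hle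
        rw [Ideal.span_singleton_le_iff_mem] at hα𝔮
        by_contra hcon
        have hlt : 𝔮 < 𝔭 := lt_of_le_not_ge hle hcon
        have hlt2 := Ideal.IsIntegral.comap_lt_comap (R := A) hlt
        rw [h𝔭P] at hlt2
        refine not_le_of_gt hlt2 ?_
        have hq1 : (𝔮.comap (algebraMap A S)).IsPrime := inferInstance
        let ι : R →+* A := (algebraMap R K).codRestrict A hDA
        have hq2 : (Ideal.span {a, b} : Ideal R) ≤ (𝔮.comap (algebraMap A S)).comap ι := by
          intro q hq
          have e : ι q = αA * ⟨_, hQA q hq⟩ := by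
            apply Subtype.ext
            change algebraMap R K q = α * (algebraMap R K q / α)
            field_simp
          rw [Ideal.mem_comap, e]
          exact Ideal.mul_mem_right _ _ hα𝔮
        have hq3 : maximalIdeal R ≤ (𝔮.comap (algebraMap A S)).comap ι := by
          rw [← hQ]
          exact (Ideal.IsPrime.radical_le_iff (hq1.comap ι)).2 hq2
        change Ideal.map φ (Ideal.map Polynomial.C (maximalIdeal R)) ≤ _
        rw [Ideal.map_map, Ideal.map_le_iff_le_comap]
        intro r hr
        have h1 := hq3 hr
        have e : (φ.comp Polynomial.C) r = ι r := by
          apply Subtype.ext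
          rw [RingHom.comp_apply, hφv]; simp; rfl
        rw [Ideal.mem_comap, e]
        exact h1
    obtain ⟨V, hSV, hV⟩ := @loc_val K _ S' hnS' hSn hfr αS 𝔭 h𝔭 hmin
    have hRV : (algebraMap R K).range ≤ V.toSubring := by
      rintro _ ⟨r, rfl⟩
      exact hSV (hAS _ (hDA r))
    obtain ⟨j, hj, hj0, hjV⟩ := val_int V hRV J
      ⟨a, (hJ a).2 fun i hi => Ideal.mul_mem_right _ _ (Ideal.subset_span (by simp)), hα0⟩ hz
    obtain ⟨d, hd𝔭, hd⟩ := hV _ hjV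
    apply hd𝔭
    apply h𝔱𝔭
    change ∀ s : S, (d : K) * algebraMap R K z * s ∈ A
    intro s
    have h1 := hJS j hj ((d * (algebraMap R K z / algebraMap R K j)) * s)
      (IsIntegral.mul hd s.2)
    convert h1 using 1
    field_simp
  obtain ⟨d, hd, hdP⟩ := SetLike.not_le_iff_exists.1 hnot
  obtain ⟨F, rfl⟩ := hφs d
  obtain ⟨i, hi⟩ := hPm F hdP
  rw [hJ]
  intro w hw
  have h1 := (hmem𝔱 _).1 hd ⟨_, hIw w hw⟩
  obtain ⟨G, hG⟩ := mem_adj_range.1 h1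
  have h2 : Polynomial.aeval T (Polynomial.C (z * w) * F - Polynomial.C a * G) = 0 := by
    have e : ((algebraMap A S (φ F) : S) : K) = Polynomial.aeval T F := rfl
    rw [e] at hG
    simp only [map_sub, map_mul, hG, Polynomial.aeval_C, ← hα]
    change _ - α * (Polynomial.aeval T F * algebraMap R K z * (algebraMap R K w / α)) = 0
    field_simp
    ring
  have h3 := hcoef _ h2 i
  rw [Polynomial.coeff_sub, Polynomial.coeff_C_mul, Polynomial.coeff_C_mul] at h3
  have h4 : z * w * F.coeff i ∈ (Ideal.span {a, b} : Ideal R) := by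
    have := add_mem h3 (Ideal.mul_mem_right (G.coeff i) _
      (Ideal.subset_span (by simp) : a ∈ (Ideal.span {a, b} : Ideal R)))
    simpa using this
  exact (Ideal.mul_unit_mem_iff_mem _ hi).1 h4

end Final

end Stmt19

theorem stmt_19 (R : Type*) [CommRing R] [IsDomain R] [IsNoetherianRing R] [IsLocalRing R]
    (hdim : ringKrullDim R = 2) (x y : R)
    (hm : maximalIdeal R = Ideal.span {x, y})
    (I : Ideal R) (hI : I.radical = maximalIdeal R)
    (hIc : I.IsIntegrallyClosedIdeal)
    (a b : R) (hQI : Ideal.span {a, b} ≤ I)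
    (hQ : (Ideal.span {a, b} : Ideal R).radical = maximalIdeal R)
    (hred : I ^ 2 = Ideal.span {a, b} * I) :
    (Submodule.colon (Ideal.span {a, b} : Ideal R) I).IsIntegrallyClosedIdeal := by
  intro z hz
  refine Stmt19.final (FractionRing R) hdim hm (fun w hw => hIc w hw) hQI hQ hred ?_ hz
  intro j
  rw [Submodule.mem_colon]
  rfl
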